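/- arXiv:math/0408077 — 4 statements merged into one kernel-verified Lean document; each statement's English description precedes it below -/
import Mathlib

section
/- Every polynomial automorphism of ℂ² is tame; that is, every ℂ-algebra automorphism of the polynomial ring ℂ[x,y] is a finite product of linear automorphisms and elementary automorphisms of the form (x,y) ↦ (x + p(y), y) for one-variable polynomials p ∈ ℂ[y]. -/
open MvPolynomial

/-- An algebra automorphism of ℂ[x,y] is *linear* if it sends each variable to a
linear form given by an invertible 2×2 matrix. -/
def IsLinearAut (σ : MvPolynomial (Fin 2) ℂ ≃ₐ[ℂ] MvPolynomial (Fin 2) ℂ) : Prop :=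
  ∃ M : Matrix (Fin 2) (Fin 2) ℂ, IsUnit M.det ∧
    ∀ i : Fin 2, σ (X i) = ∑ j : Fin 2, C (M i j) * X j

/-- An algebra automorphism of ℂ[x,y] is *elementary* if it is of the form
`(x, y) ↦ (x + p(y), y)` for a one-variable polynomial `p ∈ ℂ[y]`. -/
def IsElementaryAut (σ : MvPolynomial (Fin 2) ℂ ≃ₐ[ℂ] MvPolynomial (Fin 2) ℂ) : Prop :=
  ∃ p : Polynomial ℂ,
    σ (X 0) = X 0 + Polynomial.aeval (X 1 : MvPolynomial (Fin 2) ℂ) p ∧ σ (X 1) = X 1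

section LeadingForms

variable {σ R : Type*} [CommSemiring R]

theorem homogeneousComponent_mul_of_totalDegree_le {p q : MvPolynomial σ R} {a b : ℕ}
    (hp : p.totalDegree ≤ a) (hq : q.totalDegree ≤ b) :
    homogeneousComponent (a + b) (p * q) =
      homogeneousComponent a p * homogeneousComponent b q := by
  classical
  have key : ∀ {r : MvPolynomial σ R} {c : ℕ} {d : σ →₀ ℕ}, r.totalDegree ≤ c →
      c < d.degree → coeff d r = 0 := by
    intro r c d hr hd
    by_contra h
    have := le_totalDegree (mem_support_iff.mpr h)
    simp only [Finsupp.degree_apply, Finsupp.sum] at *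
    omega
  ext d
  rw [coeff_homogeneousComponent, coeff_mul, coeff_mul]
  split_ifs with hd
  · refine Finset.sum_congr rfl fun x hx => ?_
    rw [Finset.HasAntidiagonal.mem_antidiagonal] at hx
    have hdeg : x.1.degree + x.2.degree = a + b := by rw [← map_add, hx, hd]
    rw [coeff_homogeneousComponent, coeff_homogeneousComponent]
    rcases lt_trichotomy x.1.degree a with h | h | h
    · rw [key hq (d := x.2) (by omega)]; simp
    · rw [if_pos h, if_pos (by omega)]
    · rw [key hp h]; simp
  · refine (Finset.sum_eq_zero fun x hx => ?_).symm
    rw [Finset.HasAntidiagonal.mem_antidiagonal] at hx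
    have hdeg : x.1.degree + x.2.degree = d.degree := by rw [← map_add, hx]
    rw [coeff_homogeneousComponent, coeff_homogeneousComponent]
    split_ifs <;> first | (exfalso; omega) | simp

theorem homogeneousComponent_pow_of_totalDegree_le {p : MvPolynomial σ R} {a : ℕ}
    (hp : p.totalDegree ≤ a) (k : ℕ) :
    homogeneousComponent (k * a) (p ^ k) = homogeneousComponent a p ^ k := by
  induction k with
  | zero => simp
  | succ k ih =>
    rw [pow_succ, pow_succ, ← ih, Nat.succ_mul, homogeneousComponent_mul_of_totalDegree_le _ hp]
    exact (totalDegree_pow p k).trans (Nat.mul_le_mul_left k hp)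

theorem homogeneousComponent_totalDegree_ne_zero {p : MvPolynomial σ R} (hp : p ≠ 0) :
    homogeneousComponent p.totalDegree p ≠ 0 := by
  classical
  obtain ⟨d, hd, h⟩ := Finset.exists_mem_eq_sup p.support (support_nonempty.mpr hp)
    (fun s => s.sum fun _ e => e)
  intro h0
  have := congrArg (coeff d) h0
  rw [coeff_homogeneousComponent, if_pos, coeff_zero] at this
  · exact mem_support_iff.mp hd this
  · rw [totalDegree, h, Finsupp.degree_apply]; rfl

theorem totalDegree_lt_of_homogeneousComponent_eq_zero {p : MvPolynomial σ R} {n : ℕ}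
    (hn : n ≠ 0) (hp : p.totalDegree ≤ n) (h : homogeneousComponent n p = 0) :
    p.totalDegree < n := by
  refine lt_of_le_of_ne hp fun h' => ?_
  rcases eq_or_ne p 0 with rfl | hp0
  · exact hn (by simpa using h'.symm)
  · exact homogeneousComponent_totalDegree_ne_zero hp0 (h' ▸ h)

theorem totalDegree_pderiv_le (p : MvPolynomial σ R) (i : σ) :
    (pderiv i p).totalDegree ≤ p.totalDegree - 1 := by
  classical
  rw [totalDegree, Finset.sup_le_iff]
  intro d hd
  rw [mem_support_iff, coeff_pderiv] at hd
  have := le_totalDegree (mem_support_iff.mpr (left_ne_zero_of_mul hd))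
  change d.degree ≤ _
  change (d + Finsupp.single i 1).degree ≤ _ at this
  rw [map_add, Finsupp.degree_single] at this
  omega

end LeadingForms

theorem weight_fin_two (W : Fin 2 → ℕ) (d : Fin 2 →₀ ℕ) :
    Finsupp.weight W d = d 0 * W 0 + d 1 * W 1 := by
  simp [Finsupp.weight_apply, Finsupp.sum_fintype]

theorem homogeneousComponent_aeval {K σ : Type*} [CommSemiring K] {f : Fin 2 → MvPolynomial σ K}
    {W : Fin 2 → ℕ} (hf : ∀ i, (f i).totalDegree ≤ W i) {G : MvPolynomial (Fin 2) K} {w : ℕ}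
    (hG : ∀ d ∈ G.support, Finsupp.weight W d ≤ w) :
    homogeneousComponent w (aeval f G) =
      aeval (fun i => homogeneousComponent (W i) (f i)) (weightedHomogeneousComponent W w G) := by
  classical
  have hdeg : ∀ i k, (f i ^ k).totalDegree ≤ k * W i := fun i k =>
    (totalDegree_pow _ k).trans (Nat.mul_le_mul_left k (hf i))
  rw [weightedHomogeneousComponent_apply, map_sum]
  conv_lhs => rw [G.as_sum]
  rw [map_sum, map_sum, Finset.sum_filter]
  refine Finset.sum_congr rfl fun d hd => ?_
  rw [aeval_monomial, algebraMap_eq, homogeneousComponent_C_mul,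
    Finsupp.prod_fintype _ _ (by simp), Fin.prod_univ_two]
  split_ifs with h
  · rw [aeval_monomial, algebraMap_eq, Finsupp.prod_fintype _ _ (by simp), Fin.prod_univ_two, ← h,
      weight_fin_two, homogeneousComponent_mul_of_totalDegree_le (hdeg 0 _) (hdeg 1 _),
      homogeneousComponent_pow_of_totalDegree_le (hf 0),
      homogeneousComponent_pow_of_totalDegree_le (hf 1)]
  · rw [homogeneousComponent_eq_zero, mul_zero]
    refine ((totalDegree_mul _ _).trans (add_le_add (hdeg 0 _) (hdeg 1 _))).trans_lt ?_
    rw [← weight_fin_two]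
    exact lt_of_le_of_ne (hG d hd) h

theorem weightedHomogeneousComponent_pderiv {σ R : Type*} [CommSemiring R] (W : σ → ℕ)
    (w : ℕ) (i : σ) (G : MvPolynomial σ R) :
    weightedHomogeneousComponent W w (pderiv i G) =
      pderiv i (weightedHomogeneousComponent W (w + W i) G) := by
  classical
  ext d
  simp only [coeff_weightedHomogeneousComponent, coeff_pderiv, map_add, Finsupp.weight_single,
    one_smul, Nat.add_right_cancel_iff, ite_mul, zero_mul]

theorem pderiv_aeval_fin_two {K σ : Type*} [CommSemiring K] (f : Fin 2 → MvPolynomial σ K)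
    (i : σ) (G : MvPolynomial (Fin 2) K) :
    pderiv i (aeval f G) =
      aeval f (pderiv 0 G) * pderiv i (f 0) + aeval f (pderiv 1 G) * pderiv i (f 1) := by
  induction G using MvPolynomial.induction_on with
  | C a => simp [algebraMap_eq]
  | add p q hp hq => simp only [map_add, hp, hq]; ring
  | mul_X p j hp =>
    simp only [map_mul, pderiv_mul, hp, aeval_X, map_add]
    fin_cases j <;> simp <;> ring

section WeightedHomogeneous

variable {K S : Type*} [CommRing K] [CommRing S] [Algebra K S]

theorem eq_of_weight_eq {W : Fin 2 → ℕ} {i j : Fin 2} (hij : i ≠ j) (hW : W j ≠ 0)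
    {d e : Fin 2 →₀ ℕ} (h : Finsupp.weight W d = Finsupp.weight W e) (hi : d i = e i) :
    d = e := by
  rw [weight_fin_two, weight_fin_two] at h
  have hj : d j = e j := by
    apply Nat.eq_of_mul_eq_mul_right (Nat.pos_of_ne_zero hW)
    fin_cases i <;> fin_cases j <;> simp_all
  ext k
  fin_cases i <;> fin_cases j <;> fin_cases k <;> simp_all

theorem aeval_fin_two_eq_sum (a b : S) (Γ : MvPolynomial (Fin 2) K) :
    aeval ![a, b] Γ = ∑ d ∈ Γ.support, algebraMap K S (coeff d Γ) * (a ^ d 0 * b ^ d 1) := by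
  simp [aeval_def, eval₂_eq', Fin.prod_univ_two]

theorem aeval_C_X_ne_zero [IsDomain S] [FaithfulSMul K S] {W : Fin 2 → ℕ} (hW : W 0 ≠ 0)
    {Γ : MvPolynomial (Fin 2) K} {w : ℕ} (hΓ : IsWeightedHomogeneous W Γ w) (hΓ0 : Γ ≠ 0)
    {a : S} (ha : a ≠ 0) : aeval ![Polynomial.C a, Polynomial.X] Γ ≠ 0 := by
  classical
  obtain ⟨e, he⟩ := support_nonempty.mpr hΓ0
  intro h
  have h' := congrArg (Polynomial.coeff · (e 1)) h
  simp only [aeval_fin_two_eq_sum, Polynomial.finsetSum_coeff, Polynomial.algebraMap_apply,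
    ← Polynomial.C_pow, ← mul_assoc, ← Polynomial.C_mul, Polynomial.coeff_C_mul,
    Polynomial.coeff_X_pow, Polynomial.coeff_zero] at h'
  rw [Finset.sum_eq_single_of_mem e he, if_pos rfl, mul_one] at h'
  · refine mul_ne_zero ?_ (pow_ne_zero _ ha) h'
    rw [Ne, FaithfulSMul.algebraMap_eq_zero_iff]
    exact mem_support_iff.mp he
  · intro d hd hde
    rw [if_neg, mul_zero]
    intro h1
    exact hde (eq_of_weight_eq (i := 1) (j := 0) (by decide) hW ((hΓ (mem_support_iff.mp hd)).trans
      (hΓ (mem_support_iff.mp he)).symm) h1.symm)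

theorem natDegree_aeval_C_X_mul_le {W : Fin 2 → ℕ} {Γ : MvPolynomial (Fin 2) K} {w : ℕ}
    (hΓ : IsWeightedHomogeneous W Γ w) (a : S) :
    (aeval ![Polynomial.C a, Polynomial.X] Γ).natDegree * W 1 ≤ w := by
  rcases Nat.eq_zero_or_pos (W 1) with h0 | h0
  · simp [h0]
  rw [← Nat.le_div_iff_mul_le h0, aeval_fin_two_eq_sum]
  refine Polynomial.natDegree_sum_le_of_forall_le _ _ fun d hd => ?_
  rw [Polynomial.algebraMap_apply, ← Polynomial.C_pow, ← mul_assoc, ← Polynomial.C_mul]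
  refine (Polynomial.natDegree_C_mul_X_pow_le _ _).trans ?_
  rw [Nat.le_div_iff_mul_le h0, ← hΓ (mem_support_iff.mp hd), weight_fin_two]
  exact Nat.le_add_left _ _

theorem iterate_derivative_aeval_C_X (a : S) (Γ : MvPolynomial (Fin 2) K) (k : ℕ) :
    Polynomial.derivative^[k] (aeval ![Polynomial.C a, Polynomial.X] Γ) =
      aeval ![Polynomial.C a, Polynomial.X] ((pderiv 1)^[k] Γ) := by
  have h1 : ∀ G : MvPolynomial (Fin 2) K,
      Polynomial.derivative (aeval ![Polynomial.C a, Polynomial.X] G) =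
        aeval ![Polynomial.C a, Polynomial.X] (pderiv 1 G) := by
    intro G
    induction G using MvPolynomial.induction_on with
    | C c => simp [Polynomial.algebraMap_apply]
    | add p q hp hq => simp only [map_add, hp, hq]
    | mul_X p j hp =>
      simp only [map_mul, pderiv_mul, Polynomial.derivative_mul, hp, aeval_X, map_add]
      fin_cases j <;> simp
  induction k with
  | zero => rfl
  | succ k ih => rw [Function.iterate_succ_apply', ih, h1, Function.iterate_succ_apply']

theorem eval_aeval_C_X (a b : S) (Γ : MvPolynomial (Fin 2) K) :
    (aeval ![Polynomial.C a, Polynomial.X] Γ).eval b = aeval ![a, b] Γ := by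
  simp [aeval_fin_two_eq_sum, Polynomial.eval_finsetSum, Polynomial.algebraMap_apply]

theorem aeval_C_X_comp_C_mul_X {W : Fin 2 → ℕ} {Γ : MvPolynomial (Fin 2) K} {w : ℕ}
    (hΓ : IsWeightedHomogeneous W Γ w) (a : S) {η : S} (hη : η ^ W 0 = 1) :
    (aeval ![Polynomial.C a, Polynomial.X] Γ).comp (Polynomial.C (η ^ W 1) * Polynomial.X) =
      Polynomial.C (η ^ w) * aeval ![Polynomial.C a, Polynomial.X] Γ := by
  rw [aeval_fin_two_eq_sum, Polynomial.sum_comp, Finset.mul_sum]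
  refine Finset.sum_congr rfl fun d hd => ?_
  have hw : η ^ w = (η ^ W 1) ^ d 1 := by
    rw [← hΓ (mem_support_iff.mp hd), weight_fin_two, pow_add, mul_comm (d 0), pow_mul, hη, one_pow,
      one_mul, mul_comm, pow_mul]
  rw [hw]
  simp only [Polynomial.algebraMap_apply, Polynomial.mul_comp, Polynomial.C_comp,
    Polynomial.pow_comp, Polynomial.X_comp, mul_pow, Polynomial.C_pow]
  ring

end WeightedHomogeneous

theorem rootMultiplicity_mul_le_natDegree {S : Type*} [CommRing S] [IsDomain S]
    {P : Polynomial S} (hP : P ≠ 0) {b ζ : S} (hb : b ≠ 0) {p : ℕ} (hp : p ≠ 0)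
    (hζ : IsPrimitiveRoot ζ p) {u : S} (hu : IsUnit u)
    (h : P.comp (Polynomial.C ζ * Polynomial.X) = Polynomial.C u * P) :
    p * P.rootMultiplicity b ≤ P.natDegree := by
  classical
  have hζu : IsUnit ζ := hζ.isUnit hp
  have step : ∀ c : S, P.rootMultiplicity (ζ * c) ≤ P.rootMultiplicity c := by
    intro c
    rw [Polynomial.le_rootMultiplicity_iff hP]
    obtain ⟨Q, hQ⟩ := Polynomial.pow_rootMultiplicity_dvd P (ζ * c)
    have h2 := congrArg (Polynomial.comp · (Polynomial.C ζ * Polynomial.X)) hQ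
    simp only [h, Polynomial.mul_comp, Polynomial.pow_comp, Polynomial.sub_comp,
      Polynomial.X_comp, Polynomial.C_comp] at h2
    rw [Polynomial.C_mul, ← mul_sub, mul_pow, mul_assoc, mul_left_comm] at h2
    exact (hu.map Polynomial.C).dvd_mul_left.mp (Dvd.intro _ h2.symm)
  have steps : ∀ (i : ℕ) (c : S), P.rootMultiplicity (ζ ^ i * c) ≤ P.rootMultiplicity c := by
    intro i
    induction i with
    | zero => simp
    | succ i ih => intro c; rw [pow_succ', mul_assoc]; exact (step _).trans (ih c)
  have hle : ∀ i ∈ Finset.range p, P.rootMultiplicity b ≤ P.roots.count (ζ ^ i * b) := by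
    intro i hi
    rw [Polynomial.count_roots]
    refine le_of_eq_of_le ?_ (steps (p - i) (ζ ^ i * b))
    rw [← mul_assoc, ← pow_add, Nat.sub_add_cancel (Finset.mem_range.mp hi).le, hζ.pow_eq_one,
      one_mul]
  have hinj : Set.InjOn (fun i => ζ ^ i * b) (Finset.range p : Set ℕ) := by
    intro i hi j hj hij
    exact hζ.pow_inj (Finset.mem_range.mp hi) (Finset.mem_range.mp hj)
      (mul_right_cancel₀ hb hij)
  calc p * P.rootMultiplicity b ≤ ∑ i ∈ Finset.range p, P.roots.count (ζ ^ i * b) := by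
        simpa using Finset.card_nsmul_le_sum _ _ _ hle
    _ = ∑ c ∈ (Finset.range p).image (fun i => ζ ^ i * b), P.roots.count c :=
        (Finset.sum_image (f := fun c => P.roots.count c) hinj).symm
    _ ≤ ∑ c ∈ (Finset.range p).image (fun i => ζ ^ i * b) ∪ P.roots.toFinset, P.roots.count c :=
        Finset.sum_le_sum_of_subset Finset.subset_union_left
    _ = P.roots.card :=
        Multiset.sum_count_eq_card fun c hc =>
          Finset.mem_union_right _ (Multiset.mem_toFinset.mpr hc)
    _ ≤ P.natDegree := Polynomial.card_roots' P

theorem exists_eq_algebraMap_mul_pow {K S : Type*} [Field K] [IsAlgClosed K] [CommRing S]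
    [IsDomain S] [Algebra K S] {W : Fin 2 → ℕ} {p : ℕ} (hW : W 0 = p * W 1) (hW1 : W 1 ≠ 0)
    {Γ : MvPolynomial (Fin 2) K} {w : ℕ} (hΓ : IsWeightedHomogeneous W Γ w) (hΓ0 : Γ ≠ 0)
    {a b : S} (hb : b ≠ 0) (h : aeval ![a, b] Γ = 0) :
    ∃ c : K, a = algebraMap K S c * b ^ p := by
  classical
  obtain ⟨e, he⟩ := support_nonempty.mpr hΓ0
  have hexp : ∀ d ∈ Γ.support, d 0 * p + d 1 = e 0 * p + e 1 := by
    intro d hd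
    apply Nat.eq_of_mul_eq_mul_right (Nat.pos_of_ne_zero hW1)
    have := (hΓ (mem_support_iff.mp hd)).trans (hΓ (mem_support_iff.mp he)).symm
    rw [weight_fin_two, weight_fin_two, hW] at this
    linarith
  let L := FractionRing S
  have hbL : algebraMap S L b ≠ 0 := by simpa using hb
  obtain ⟨t, hat⟩ : ∃ t : L, algebraMap S L a = t * algebraMap S L b ^ p :=
    ⟨algebraMap S L a / algebraMap S L b ^ p, (div_mul_cancel₀ _ (pow_ne_zero _ hbL)).symm⟩
  set Q : Polynomial K := aeval ![Polynomial.X, 1] Γ with hQ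
  have hQ0 : Q ≠ 0 := by
    intro h0
    have h' := congrArg (Polynomial.coeff · (e 0)) h0
    simp only [hQ, aeval_fin_two_eq_sum, Polynomial.finsetSum_coeff,
      Polynomial.algebraMap_eq, one_pow, mul_one, Polynomial.coeff_C_mul_X_pow,
      Polynomial.coeff_zero] at h'
    rw [Finset.sum_eq_single_of_mem e he, if_pos rfl] at h'
    · exact mem_support_iff.mp he h'
    · intro d hd hde
      rw [if_neg]
      intro h1
      exact hde (eq_of_weight_eq (i := 0) (j := 1) (by decide) hW1
        ((hΓ (mem_support_iff.mp hd)).trans (hΓ (mem_support_iff.mp he)).symm) h1.symm)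
  have hQt : Polynomial.aeval t Q = 0 := by
    have h1 : algebraMap S L (aeval ![a, b] Γ) =
        algebraMap S L b ^ (e 0 * p + e 1) * Polynomial.aeval t Q := by
      rw [hQ, aeval_fin_two_eq_sum, aeval_fin_two_eq_sum, map_sum, map_sum, Finset.mul_sum]
      refine Finset.sum_congr rfl fun d hd => ?_
      rw [← hexp d hd]
      simp only [map_mul, map_pow, ← IsScalarTower.algebraMap_apply, Polynomial.algebraMap_eq,
        Polynomial.aeval_C, Polynomial.aeval_X, one_pow, mul_one]
      rw [hat, mul_pow, ← pow_mul, pow_add, mul_comm p]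
      ring
    rw [h, map_zero, eq_comm, mul_eq_zero] at h1
    exact h1.resolve_left (pow_ne_zero _ hbL)
  have hmem : ∃ c, algebraMap K L c = t := by
    have ht_integral : IsIntegral K t := isAlgebraic_iff_isIntegral.mp ⟨Q, hQ0, hQt⟩
    exact minpoly.mem_range_of_degree_eq_one K t
      (IsAlgClosed.degree_eq_one_of_irreducible K (minpoly.irreducible ht_integral))
  obtain ⟨c, hc⟩ := hmem
  refine ⟨c, IsFractionRing.injective S L ?_⟩
  rw [map_mul, map_pow, ← IsScalarTower.algebraMap_apply, hc, hat]

section Automorphisms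

variable {K : Type*} [Field K]

theorem algEquiv_apply_eq_aeval {σ R A : Type*} [CommSemiring R] [CommSemiring A] [Algebra R A]
    (φ : MvPolynomial σ R ≃ₐ[R] A) (G : MvPolynomial σ R) :
    φ G = aeval (fun i => φ (X i)) G :=
  DFunLike.congr_fun (aeval_unique (φ : MvPolynomial σ R →ₐ[R] A)) G

theorem pderiv_algEquiv (φ : MvPolynomial (Fin 2) K ≃ₐ[K] MvPolynomial (Fin 2) K) (i : Fin 2)
    (G : MvPolynomial (Fin 2) K) :
    pderiv i (φ G) =
      φ (pderiv 0 G) * pderiv i (φ (X 0)) + φ (pderiv 1 G) * pderiv i (φ (X 1)) := by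
  simpa only [← algEquiv_apply_eq_aeval] using pderiv_aeval_fin_two (fun i => φ (X i)) i G

/-- The Jacobian determinant of a pair of polynomials in two variables. -/
noncomputable def jacobianDet {R : Type*} [CommRing R] (f g : MvPolynomial (Fin 2) R) :
    MvPolynomial (Fin 2) R :=
  pderiv 0 f * pderiv 1 g - pderiv 1 f * pderiv 0 g

theorem exists_jacobianDet_eq_C (φ : MvPolynomial (Fin 2) K ≃ₐ[K] MvPolynomial (Fin 2) K) :
    ∃ c : K, c ≠ 0 ∧ jacobianDet (φ (X 0)) (φ (X 1)) = C c := by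
  have h : ∀ i j : Fin 2, pderiv i (X j) = _ := fun i j => by
    simpa using pderiv_algEquiv φ i (φ.symm (X j))
  have h00 := h 0 0
  have h01 := h 0 1
  have h10 := h 1 0
  have h11 := h 1 1
  rw [pderiv_X_self] at h00 h11
  rw [pderiv_X_of_ne (by decide)] at h01 h10
  have hu : IsUnit (jacobianDet (φ (X 0)) (φ (X 1))) := by
    refine IsUnit.of_mul_eq_one (φ (pderiv 0 (φ.symm (X 0))) * φ (pderiv 1 (φ.symm (X 1))) -
      φ (pderiv 1 (φ.symm (X 0))) * φ (pderiv 0 (φ.symm (X 1)))) ?_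
    have := congrArg₂ (· - ·) (congrArg₂ (· * ·) h00 h11) (congrArg₂ (· * ·) h10 h01)
    simp only [mul_one, mul_zero, sub_zero] at this
    rw [this, jacobianDet]
    ring
  obtain ⟨c, hc, h⟩ := isUnit_iff_eq_C_of_isReduced.mp hu
  exact ⟨c, hc.ne_zero, h⟩

theorem jacobianDet_algEquiv (φ : MvPolynomial (Fin 2) K ≃ₐ[K] MvPolynomial (Fin 2) K)
    (G : MvPolynomial (Fin 2) K) :
    jacobianDet (φ (X 0)) (φ G) = φ (pderiv 1 G) * jacobianDet (φ (X 0)) (φ (X 1)) := by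
  rw [jacobianDet, jacobianDet, pderiv_algEquiv φ 0 G, pderiv_algEquiv φ 1 G]
  ring

theorem totalDegree_jacobianDet_le {R : Type*} [CommRing R] {f : MvPolynomial (Fin 2) R}
    (hf : 2 ≤ f.totalDegree) (h : MvPolynomial (Fin 2) R) :
    (jacobianDet f h).totalDegree ≤ h.totalDegree + (f.totalDegree - 2) := by
  rcases Nat.eq_zero_or_pos h.totalDegree with h0 | h0
  · rw [totalDegree_eq_zero_iff_eq_C.mp h0]
    simp [jacobianDet]
  · have key : ∀ i j : Fin 2, (pderiv i f * pderiv j h).totalDegree ≤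
        h.totalDegree + (f.totalDegree - 2) := by
      intro i j
      have h1 := totalDegree_pderiv_le f i
      have h2 := totalDegree_pderiv_le h j
      have h3 := totalDegree_mul (pderiv i f) (pderiv j h)
      omega
    exact (totalDegree_sub _ _).trans (max_le (key 0 1) (key 1 0))

theorem totalDegree_algEquiv_pderiv_le
    (φ : MvPolynomial (Fin 2) K ≃ₐ[K] MvPolynomial (Fin 2) K)
    (hφ : 2 ≤ (φ (X 0)).totalDegree) (G : MvPolynomial (Fin 2) K) :
    (φ (pderiv 1 G)).totalDegree ≤ (φ G).totalDegree + ((φ (X 0)).totalDegree - 2) := by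
  obtain ⟨c, hc, hJ⟩ := exists_jacobianDet_eq_C φ
  have h := totalDegree_jacobianDet_le hφ (φ G)
  rw [jacobianDet_algEquiv, hJ] at h
  rcases eq_or_ne (φ (pderiv 1 G)) 0 with h0 | h0
  · simp [h0]
  · rwa [totalDegree_mul_of_isDomain h0 (by simpa using hc), totalDegree_C, add_zero] at h

theorem totalDegree_algEquiv_iterate_pderiv_le
    (φ : MvPolynomial (Fin 2) K ≃ₐ[K] MvPolynomial (Fin 2) K)
    (hφ : 2 ≤ (φ (X 0)).totalDegree) (G : MvPolynomial (Fin 2) K) (k : ℕ) :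
    (φ ((pderiv 1)^[k] G)).totalDegree ≤
      (φ G).totalDegree + k * ((φ (X 0)).totalDegree - 2) := by
  induction k with
  | zero => simp
  | succ k ih =>
    rw [Function.iterate_succ_apply', Nat.succ_mul]
    have := totalDegree_algEquiv_pderiv_le φ hφ ((pderiv 1)^[k] G)
    omega

theorem totalDegree_algEquiv_X_ne_zero {σ τ : Type*}
    (φ : MvPolynomial σ K ≃ₐ[K] MvPolynomial τ K) (i : σ) : (φ (X i)).totalDegree ≠ 0 := by
  intro h
  have h' := totalDegree_eq_zero_iff_eq_C.mp h
  rw [← algebraMap_eq, ← φ.commutes, φ.injective.eq_iff, algebraMap_eq] at h'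
  have := congrArg totalDegree h'
  simp at this

theorem weightedHomogeneousComponent_weightedTotalDegree_ne_zero {σ R : Type*} [CommSemiring R]
    (W : σ → ℕ) {G : MvPolynomial σ R} (hG : G ≠ 0) :
    weightedHomogeneousComponent W (weightedTotalDegree W G) G ≠ 0 := by
  classical
  obtain ⟨d, hd, h⟩ := Finset.exists_mem_eq_sup G.support (support_nonempty.mpr hG)
    (Finsupp.weight W)
  intro h0
  have := congrArg (coeff d) h0
  rw [coeff_weightedHomogeneousComponent, weightedTotalDegree, if_pos h.symm, coeff_zero] at this
  exact mem_support_iff.mp hd this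

/-- If the top weighted homogeneous component of `G` is not a relation between the leading forms
of the images of the variables, then the degree of the image of `G` does not drop. -/
theorem weightedTotalDegree_le_of_aeval_ne_zero
    (φ : MvPolynomial (Fin 2) K ≃ₐ[K] MvPolynomial (Fin 2) K) {W : Fin 2 → ℕ}
    (hW : ∀ i, W i = (φ (X i)).totalDegree) {G : MvPolynomial (Fin 2) K} {w : ℕ}
    (hG : ∀ d ∈ G.support, Finsupp.weight W d ≤ w)
    (h : aeval (fun i => homogeneousComponent (W i) (φ (X i)))
      (weightedHomogeneousComponent W w G) ≠ 0) : w ≤ (φ G).totalDegree := by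
  rw [← homogeneousComponent_aeval (fun i => (hW i).ge) hG, ← algEquiv_apply_eq_aeval] at h
  by_contra! hlt
  exact h (homogeneousComponent_eq_zero _ _ hlt)

theorem exists_totalDegree_le_one_and_aeval_eq_zero
    (φ : MvPolynomial (Fin 2) K ≃ₐ[K] MvPolynomial (Fin 2) K) {W : Fin 2 → ℕ}
    (hW : ∀ i, W i = (φ (X i)).totalDegree) (hW0 : 2 ≤ W 0) :
    ∃ G : MvPolynomial (Fin 2) K, G ≠ 0 ∧ (φ G).totalDegree ≤ 1 ∧
      aeval (fun i => homogeneousComponent (W i) (φ (X i)))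
        (weightedHomogeneousComponent W (weightedTotalDegree W G) G) = 0 := by
  by_contra! hcon
  have h0 : ∀ j, pderiv 0 (φ.symm (X j)) = 0 := by
    intro j
    have hdeg : (φ (φ.symm (X j))).totalDegree ≤ 1 := by simp
    have hle := (weightedTotalDegree_le_of_aeval_ne_zero φ hW
      (fun d hd => le_weightedTotalDegree W hd) (hcon _ (by simp) hdeg)).trans hdeg
    apply pderiv_eq_zero_of_notMem_vars
    intro hmem
    obtain ⟨d, hd, hd0⟩ := (mem_vars_iff_mem_support 0).mp hmem
    have h1 := (le_weightedTotalDegree W hd).trans hle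
    rw [weight_fin_two] at h1
    have h2 : 1 ≤ d 0 := Nat.one_le_iff_ne_zero.mpr (Finsupp.mem_support_iff.mp hd0)
    nlinarith
  have h : ∀ i j : Fin 2, pderiv i (X j) = _ := fun i j => by
    simpa [h0] using pderiv_algEquiv φ i (φ.symm (X j))
  have h00 := h 0 0
  have h10 := h 1 0
  have h11 := h 1 1
  rw [pderiv_X_self] at h00 h11
  rw [pderiv_X_of_ne (by decide), eq_comm, mul_eq_zero] at h10
  rcases h10 with h10 | h10
  · rw [h10, zero_mul] at h00
    exact one_ne_zero h00
  · rw [h10, mul_zero] at h11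
    exact one_ne_zero h11

end Automorphisms

theorem weightedHomogeneousComponent_iterate_pderiv {σ R : Type*} [CommSemiring R] (W : σ → ℕ)
    (w : ℕ) (i : σ) (G : MvPolynomial σ R) (k : ℕ) :
    weightedHomogeneousComponent W w ((pderiv i)^[k] G) =
      (pderiv i)^[k] (weightedHomogeneousComponent W (w + k * W i) G) := by
  induction k generalizing w with
  | zero => simp
  | succ k ih =>
    rw [Function.iterate_succ_apply', weightedHomogeneousComponent_pderiv, ih,
      Function.iterate_succ_apply', Nat.succ_mul, add_assoc, add_comm (W i)]

theorem weight_add_le_of_mem_support_iterate_pderiv {σ R : Type*} [CommSemiring R] {W : σ → ℕ}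
    {w : ℕ} (i : σ) {G : MvPolynomial σ R} (hG : ∀ d ∈ G.support, Finsupp.weight W d ≤ w) (k : ℕ) :
    ∀ d ∈ ((pderiv i)^[k] G).support, Finsupp.weight W d + k * W i ≤ w := by
  classical
  induction k with
  | zero => simpa using hG
  | succ k ih =>
    intro d hd
    rw [Function.iterate_succ_apply', mem_support_iff, coeff_pderiv] at hd
    have := ih _ (mem_support_iff.mpr (left_ne_zero_of_mul hd))
    rw [map_add, Finsupp.weight_single, one_smul] at this
    rw [Nat.succ_mul]
    omega

theorem exists_leadingForm_eq {K : Type*} [Field K] [IsAlgClosed K] [CharZero K]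
    (φ : MvPolynomial (Fin 2) K ≃ₐ[K] MvPolynomial (Fin 2) K) {W : Fin 2 → ℕ}
    (hW : ∀ i, W i = (φ (X i)).totalDegree) (hW0 : 2 ≤ W 0) (hle : W 1 ≤ W 0) :
    ∃ (p : ℕ) (c : K), W 0 = p * W 1 ∧ homogeneousComponent (W 0) (φ (X 0)) =
      C c * homogeneousComponent (W 1) (φ (X 1)) ^ p := by
  obtain ⟨G, hG0, hdeg, hrel⟩ := exists_totalDegree_le_one_and_aeval_eq_zero φ hW hW0
  have hW1 : W 1 ≠ 0 := hW 1 ▸ totalDegree_algEquiv_X_ne_zero φ 1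
  have hlead : ∀ i, homogeneousComponent (W i) (φ (X i)) ≠ 0 := fun i =>
    hW i ▸ homogeneousComponent_totalDegree_ne_zero (by simp)
  set w := weightedTotalDegree W G
  have hGw : ∀ d ∈ G.support, Finsupp.weight W d ≤ w := fun d hd => le_weightedTotalDegree W hd
  set Γ := weightedHomogeneousComponent W w G with hΓdef
  have hΓ0 : Γ ≠ 0 := weightedHomogeneousComponent_weightedTotalDegree_ne_zero W hG0
  have hΓ : IsWeightedHomogeneous W Γ w := weightedHomogeneousComponent_isWeightedHomogeneous w G
  have hvec : (fun i => homogeneousComponent (W i) (φ (X i))) =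
      ![homogeneousComponent (W 0) (φ (X 0)), homogeneousComponent (W 1) (φ (X 1))] := by
    ext1 i
    fin_cases i <;> rfl
  set a := homogeneousComponent (W 0) (φ (X 0))
  set b := homogeneousComponent (W 1) (φ (X 1))
  have ha : a ≠ 0 := hlead 0
  have hb : b ≠ 0 := hlead 1
  rw [hvec] at hrel
  set P : Polynomial (MvPolynomial (Fin 2) K) := aeval ![Polynomial.C a, Polynomial.X] Γ with hP
  have hP0 : P ≠ 0 := aeval_C_X_ne_zero (by omega) hΓ hΓ0 ha
  set k := P.rootMultiplicity b
  have hk0 : 0 < k := (Polynomial.rootMultiplicity_pos hP0).mpr (by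
    rw [Polynomial.IsRoot, hP, eval_aeval_C_X, hrel])
  have : NeZero (W 0) := ⟨by omega⟩
  obtain ⟨η, hη⟩ := HasEnoughRootsOfUnity.exists_primitiveRoot K (W 0)
  have hηS := hη.map_of_injective (FaithfulSMul.algebraMap_injective K (MvPolynomial (Fin 2) K))
  set ζ := algebraMap K (MvPolynomial (Fin 2) K) η
  have hζ : IsPrimitiveRoot (ζ ^ W 1) (W 0 / (W 0).gcd (W 1)) := by
    have := IsPrimitiveRoot.orderOf (ζ ^ W 1)
    rwa [orderOf_pow' _ hW1, ← hηS.eq_orderOf] at this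
  obtain ⟨p, hp⟩ := Nat.gcd_dvd_left (W 0) (W 1)
  obtain ⟨s, hs⟩ := Nat.gcd_dvd_right (W 0) (W 1)
  have hgpos : 0 < (W 0).gcd (W 1) := Nat.gcd_pos_of_pos_left _ (by omega)
  set g := (W 0).gcd (W 1)
  have hp' : W 0 / g = p := by rw [hp, Nat.mul_div_cancel_left _ hgpos]
  have hp0 : p ≠ 0 := by rintro rfl; omega
  rw [hp'] at hζ
  have h1 : p * k ≤ P.natDegree := rootMultiplicity_mul_le_natDegree hP0 hb hp0 hζ
    ((hηS.isUnit (by omega)).pow w) (aeval_C_X_comp_C_mul_X hΓ a hηS.pow_eq_one)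
  have h2 : P.natDegree * W 1 ≤ w := natDegree_aeval_C_X_mul_le hΓ a
  have h3 : k * W 1 ≤ w :=
    (Nat.mul_le_mul_right _ (Nat.le_mul_of_pos_left k (Nat.pos_of_ne_zero hp0))).trans
      ((Nat.mul_le_mul_right _ h1).trans h2)
  have h4 : aeval (fun i => homogeneousComponent (W i) (φ (X i)))
      (weightedHomogeneousComponent W (w - k * W 1) ((pderiv 1)^[k] G)) ≠ 0 := by
    rw [hvec, weightedHomogeneousComponent_iterate_pderiv, Nat.sub_add_cancel h3, ← hΓdef,
      ← eval_aeval_C_X, ← iterate_derivative_aeval_C_X, ← hP,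
      Polynomial.eval_iterate_derivative_rootMultiplicity]
    exact smul_ne_zero (Nat.factorial_ne_zero _)
      (Polynomial.eval_divByMonic_pow_rootMultiplicity_ne_zero b hP0)
  have h5 := weightedTotalDegree_le_of_aeval_ne_zero φ hW (fun d hd => Nat.le_sub_of_add_le
    (weight_add_le_of_mem_support_iterate_pderiv 1 hGw k d hd)) h4
  have h6 := totalDegree_algEquiv_iterate_pderiv_le φ (hW 0 ▸ hW0) G k
  rw [← hW 0] at h6
  have hs1 : s = 1 := by
    by_contra hs1
    have hs0 : s ≠ 0 := by rintro rfl; omega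
    have hs2 : 2 ≤ s := by omega
    obtain ⟨r, hr⟩ := Nat.exists_eq_add_of_le hW0
    have h7 : k * W 0 * 2 ≤ w := calc
      k * W 0 * 2 ≤ k * W 0 * s := Nat.mul_le_mul_left _ hs2
      _ = p * k * W 1 := by rw [hs]; nth_rewrite 1 [hp]; ring
      _ ≤ w := (Nat.mul_le_mul_right _ h1).trans h2
    have h8 : k * W 1 ≤ k * W 0 := Nat.mul_le_mul_left _ hle
    have h9 : k * (W 0 - 2) + 2 * k = k * W 0 := by
      rw [hr, Nat.add_sub_cancel_left]; ring
    omega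
  rw [hs1, mul_one] at hs
  have hWp : W 0 = p * W 1 := by rw [hs, mul_comm]; exact hp
  obtain ⟨c, hc⟩ := exists_eq_algebraMap_mul_pow hWp hW1 hΓ hΓ0 hb hrel
  exact ⟨p, c, hWp, hc⟩

section Tame

/-- The elementary automorphism `(x, y) ↦ (x + p(y), y)`. -/
noncomputable def elementaryAut {R : Type*} [CommRing R] (p : Polynomial R) :
    MvPolynomial (Fin 2) R ≃ₐ[R] MvPolynomial (Fin 2) R :=
  AlgEquiv.ofAlgHom (aeval ![X 0 + Polynomial.aeval (X 1) p, X 1])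
    (aeval ![X 0 - Polynomial.aeval (X 1) p, X 1])
    (by ext i : 1; fin_cases i <;> simp [← Polynomial.aeval_algHom_apply])
    (by ext i : 1; fin_cases i <;> simp [← Polynomial.aeval_algHom_apply])

@[simp]
theorem elementaryAut_X_zero {R : Type*} [CommRing R] (p : Polynomial R) :
    elementaryAut p (X 0) = X 0 + Polynomial.aeval (X 1) p := by
  simp [elementaryAut]

@[simp]
theorem elementaryAut_X_one {R : Type*} [CommRing R] (p : Polynomial R) :
    elementaryAut p (X 1) = X 1 := by
  simp [elementaryAut]

/-- The automorphism exchanging the two variables. -/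
noncomputable def swapAut (R : Type*) [CommRing R] :
    MvPolynomial (Fin 2) R ≃ₐ[R] MvPolynomial (Fin 2) R :=
  renameEquiv R (Equiv.swap 0 1)

@[simp]
theorem swapAut_X_zero (R : Type*) [CommRing R] : swapAut R (X 0) = X 1 := by
  simp [swapAut]

@[simp]
theorem swapAut_X_one (R : Type*) [CommRing R] : swapAut R (X 1) = X 0 := by
  simp [swapAut]

/-- The subgroup of tame automorphisms of `ℂ[x, y]`. -/
noncomputable abbrev tameSubgroup :
    Subgroup (MvPolynomial (Fin 2) ℂ ≃ₐ[ℂ] MvPolynomial (Fin 2) ℂ) :=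
  Subgroup.closure {τ | IsLinearAut τ ∨ IsElementaryAut τ}

theorem elementaryAut_mem_tameSubgroup (p : Polynomial ℂ) : elementaryAut p ∈ tameSubgroup :=
  Subgroup.subset_closure (Or.inr ⟨p, by simp, by simp⟩)

theorem swapAut_mem_tameSubgroup : swapAut ℂ ∈ tameSubgroup := by
  refine Subgroup.subset_closure (Or.inl ⟨!![0, 1; 1, 0], ?_, ?_⟩)
  · simp [Matrix.det_fin_two]
  · intro i
    fin_cases i <;> simp

theorem eq_C_add_of_totalDegree_le_one {R : Type*} [CommSemiring R] {p : MvPolynomial (Fin 2) R}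
    (hp : p.totalDegree ≤ 1) : p = C (coeff 0 p) +
      (C (coeff (Finsupp.single 0 1) p) * X 0 + C (coeff (Finsupp.single 1 1) p) * X 1) := by
  classical
  have h1 : homogeneousComponent 1 p =
      C (coeff (Finsupp.single 0 1) p) * X 0 + C (coeff (Finsupp.single 1 1) p) * X 1 := by
    ext d
    rw [coeff_homogeneousComponent]
    split_ifs with hd
    · obtain ⟨i, rfl⟩ : ∃ i, Finsupp.single i 1 = d := by
        rw [Finsupp.degree_eq_sum, Fin.sum_univ_two] at hd
        rcases Nat.add_eq_one_iff.mp hd with h | h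
        · refine ⟨1, Finsupp.ext fun j => ?_⟩
          fin_cases j <;> simp [h]
        · refine ⟨0, Finsupp.ext fun j => ?_⟩
          fin_cases j <;> simp [h]
      fin_cases i <;> simp [coeff_C_mul, coeff_X, Finsupp.single_left_inj]
    · have hne : ∀ i, Finsupp.single i 1 ≠ d := by
        rintro i rfl
        exact hd (Finsupp.degree_single i 1)
      simp [coeff_C_mul, coeff_X, hne]
  rw [← h1, ← homogeneousComponent_zero]
  conv_lhs => rw [← sum_homogeneousComponent p]
  interval_cases hdeg : p.totalDegree
  · simp [homogeneousComponent_eq_zero 1 p (by omega)]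
  · simp [Finset.sum_range_succ]

theorem mem_tameSubgroup_of_totalDegree_le_one
    {φ : MvPolynomial (Fin 2) ℂ ≃ₐ[ℂ] MvPolynomial (Fin 2) ℂ}
    (h : ∀ i, (φ (X i)).totalDegree ≤ 1) : φ ∈ tameSubgroup := by
  have h0 := eq_C_add_of_totalDegree_le_one (h 0)
  have h1 := eq_C_add_of_totalDegree_le_one (h 1)
  set M : Matrix (Fin 2) (Fin 2) ℂ :=
    Matrix.of fun i j => coeff (Finsupp.single j 1) (φ (X i)) with hM
  set τ := elementaryAut (Polynomial.C (-coeff 0 (φ (X 0)))) *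
    (swapAut ℂ * elementaryAut (Polynomial.C (-coeff 0 (φ (X 1)))) * swapAut ℂ) with hτ
  have hτmem : τ ∈ tameSubgroup :=
    mul_mem (elementaryAut_mem_tameSubgroup _) (mul_mem (mul_mem swapAut_mem_tameSubgroup
      (elementaryAut_mem_tameSubgroup _)) swapAut_mem_tameSubgroup)
  rw [← mul_mem_cancel_right hτmem]
  have hC : ∀ (ψ : MvPolynomial (Fin 2) ℂ ≃ₐ[ℂ] MvPolynomial (Fin 2) ℂ) (r : ℂ),
      ψ (C r) = C r := fun ψ r => ψ.commutes r
  have hlin : ∀ i, (φ * τ) (X i) = ∑ j, C (M i j) * X j := by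
    intro i
    rw [Fin.sum_univ_two]
    fin_cases i
    · calc (φ * τ) (X 0) = φ (X 0) - C (coeff 0 (φ (X 0))) := by
            simp [hτ, algebraMap_eq, hC, sub_eq_add_neg]
        _ = _ := by nth_rewrite 1 [h0]; simp [hM]
    · calc (φ * τ) (X 1) = φ (X 1) - C (coeff 0 (φ (X 1))) := by
            simp [hτ, algebraMap_eq, hC, sub_eq_add_neg]
        _ = _ := by nth_rewrite 1 [h1]; simp [hM]
  refine Subgroup.subset_closure (Or.inl ⟨M, ?_, hlin⟩)
  obtain ⟨c, hc, hJ⟩ := exists_jacobianDet_eq_C (φ * τ)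
  rw [hlin, hlin, Fin.sum_univ_two, Fin.sum_univ_two] at hJ
  have : M.det = c := by
    apply C_injective (Fin 2) ℂ
    rw [← hJ, jacobianDet, Matrix.det_fin_two]
    simp [pderiv_X]
  rw [this]
  exact hc.isUnit

theorem mem_tameSubgroup (φ : MvPolynomial (Fin 2) ℂ ≃ₐ[ℂ] MvPolynomial (Fin 2) ℂ) :
    φ ∈ tameSubgroup := by
  induction hN : (φ (X 0)).totalDegree + (φ (X 1)).totalDegree using Nat.strong_induction_on
    generalizing φ with
  | _ N ih =>
    wlog hle : (φ (X 1)).totalDegree ≤ (φ (X 0)).totalDegree generalizing φ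
    · rw [← mul_mem_cancel_right swapAut_mem_tameSubgroup]
      refine this (φ * swapAut ℂ) ?_ ?_
      · simp [← hN, add_comm]
      · simpa using (not_le.mp hle).le
    rcases Nat.lt_or_ge (φ (X 0)).totalDegree 2 with h2 | h2
    · refine mem_tameSubgroup_of_totalDegree_le_one fun i => ?_
      fin_cases i
      · exact Nat.le_of_lt_succ h2
      · exact hle.trans (Nat.le_of_lt_succ h2)
    · obtain ⟨p, c, hp, hc⟩ := exists_leadingForm_eq φ (W := fun i => (φ (X i)).totalDegree)
        (fun _ => rfl) h2 hle
      set ε : MvPolynomial (Fin 2) ℂ ≃ₐ[ℂ] MvPolynomial (Fin 2) ℂ :=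
        elementaryAut (Polynomial.C (-c) * Polynomial.X ^ p) with hε
      have hεmem : ε ∈ tameSubgroup := elementaryAut_mem_tameSubgroup _
      rw [← mul_mem_cancel_right hεmem]
      refine ih _ ?_ _ rfl
      have hX0 : (φ * ε) (X 0) = φ (X 0) - C c * φ (X 1) ^ p := by
        have hC : φ (C c) = C c := φ.commutes c
        simp [hε, algebraMap_eq, hC, sub_eq_add_neg]
      rw [← hN, hX0, AlgEquiv.mul_apply, hε, elementaryAut_X_one, Nat.add_lt_add_iff_right]
      have hdeg : (C c * φ (X 1) ^ p).totalDegree ≤ (φ (X 0)).totalDegree := by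
        refine (totalDegree_mul _ _).trans ?_
        rw [totalDegree_C, zero_add, hp]
        exact totalDegree_pow _ _
      refine totalDegree_lt_of_homogeneousComponent_eq_zero (by omega)
        ((totalDegree_sub _ _).trans (max_le le_rfl hdeg)) ?_
      rw [map_sub, homogeneousComponent_C_mul, sub_eq_zero, hc, hp,
        homogeneousComponent_pow_of_totalDegree_le le_rfl]

end Tame

/-- **Jung's Automorphism Theorem.** Every polynomial automorphism of ℂ² is tame:
every ℂ-algebra automorphism of ℂ[x,y] is a finite product of linear automorphisms
and elementary automorphisms. -/
theorem jung_automorphism_theorem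
    (σ : MvPolynomial (Fin 2) ℂ ≃ₐ[ℂ] MvPolynomial (Fin 2) ℂ) :
    σ ∈ Subgroup.closure {τ : MvPolynomial (Fin 2) ℂ ≃ₐ[ℂ] MvPolynomial (Fin 2) ℂ |
      IsLinearAut τ ∨ IsElementaryAut τ} := by
  exact mem_tameSubgroup σ
end

section
/- Division Lemma: if F = (P,Q) is a polynomial automorphism of ℂ², then deg P divides deg Q or deg Q divides deg P, where deg denotes total degree. -/
open MvPolynomial

/-- `(P, Q)` is a polynomial automorphism of ℂ²: the polynomial map
`F(x,y) = (P(x,y), Q(x,y))` admits a polynomial inverse `(P', Q')`. -/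
def IsPolyAut (P Q : MvPolynomial (Fin 2) ℂ) : Prop :=
  ∃ P' Q' : MvPolynomial (Fin 2) ℂ,
    (∀ v : Fin 2 → ℂ,
      eval ![eval v P, eval v Q] P' = v 0 ∧ eval ![eval v P, eval v Q] Q' = v 1) ∧
    (∀ v : Fin 2 → ℂ,
      eval ![eval v P', eval v Q'] P = v 0 ∧ eval ![eval v P', eval v Q'] Q = v 1)

section Jacobian

variable {R : Type*} [CommRing R]

/-- The Jacobian determinant of a pair of bivariate polynomials. -/
noncomputable def jacobian (f g : MvPolynomial (Fin 2) R) : MvPolynomial (Fin 2) R :=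
  pderiv 0 f * pderiv 1 g - pderiv 1 f * pderiv 0 g

theorem pderiv_aeval_pair (i : Fin 2) (f g G : MvPolynomial (Fin 2) R) :
    pderiv i (aeval ![f, g] G) =
      aeval ![f, g] (pderiv 0 G) * pderiv i f + aeval ![f, g] (pderiv 1 G) * pderiv i g := by
  induction G using MvPolynomial.induction_on with
  | C a => simp
  | add p q hp hq => simp only [map_add, hp, hq]; ring
  | mul_X p j hp =>
    fin_cases j <;> simp [hp, pderiv_X, Derivation.leibniz, -aeval_eq_bind₁] <;> ring

theorem jacobian_aeval_right (f g G : MvPolynomial (Fin 2) R) :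
    jacobian f (aeval ![f, g] G) = aeval ![f, g] (pderiv 1 G) * jacobian f g := by
  simp only [jacobian, pderiv_aeval_pair]; ring

theorem jacobian_aeval_aeval (f g G H : MvPolynomial (Fin 2) R) :
    jacobian (aeval ![f, g] G) (aeval ![f, g] H) =
      aeval ![f, g] (jacobian G H) * jacobian f g := by
  simp only [jacobian, pderiv_aeval_pair, map_sub, map_mul]; ring

theorem jacobian_ne_zero_of_left_inverse [Nontrivial R] {f g G H : MvPolynomial (Fin 2) R}
    (hG : aeval ![f, g] G = X 0) (hH : aeval ![f, g] H = X 1) : jacobian f g ≠ 0 := by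
  intro h
  have := jacobian_aeval_aeval f g G H
  rw [hG, hH, h, mul_zero] at this
  simp [jacobian, pderiv_X] at this

theorem totalDegree_pderiv_add_one_le {σ : Type*} (i : σ) (f : MvPolynomial σ R)
    (h : pderiv i f ≠ 0) : (pderiv i f).totalDegree + 1 ≤ f.totalDegree := by
  classical
  have key : ∀ s ∈ (pderiv i f).support, (s.sum fun _ e => e) + 1 ≤ f.totalDegree := by
    intro s hs
    rw [mem_support_iff, coeff_pderiv] at hs
    have hs' : s + Finsupp.single i 1 ∈ f.support := by
      rw [mem_support_iff]; intro h0; simp [h0] at hs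
    have := le_totalDegree hs'
    rwa [Finsupp.sum_add_index' (by simp) (by simp), Finsupp.sum_single_index rfl] at this
  obtain ⟨s, hs⟩ := support_nonempty.mpr h
  have h1 := key s hs
  have : (pderiv i f).totalDegree ≤ f.totalDegree - 1 :=
    Finset.sup_le fun s hs => by have := key s hs; omega
  omega

theorem totalDegree_pderiv_mul_pderiv_add_two_le {σ : Type*} (i j : σ) (f g : MvPolynomial σ R)
    (h : pderiv i f * pderiv j g ≠ 0) :
    (pderiv i f * pderiv j g).totalDegree + 2 ≤ f.totalDegree + g.totalDegree := by
  have h1 := totalDegree_pderiv_add_one_le i f (left_ne_zero_of_mul h)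
  have h2 := totalDegree_pderiv_add_one_le j g (right_ne_zero_of_mul h)
  have := totalDegree_mul (pderiv i f) (pderiv j g)
  omega

theorem totalDegree_jacobian_add_two_le (f g : MvPolynomial (Fin 2) R) (h : jacobian f g ≠ 0) :
    (jacobian f g).totalDegree + 2 ≤ f.totalDegree + g.totalDegree := by
  unfold jacobian at h ⊢
  have h1 := totalDegree_pderiv_mul_pderiv_add_two_le 0 1 f g
  have h2 := totalDegree_pderiv_mul_pderiv_add_two_le 1 0 f g
  have h3 := totalDegree_sub (pderiv 0 f * pderiv 1 g) (pderiv 1 f * pderiv 0 g)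
  by_cases ha : pderiv 0 f * pderiv 1 g = 0
  · have hb : pderiv 1 f * pderiv 0 g ≠ 0 := by rintro hb; simp [ha, hb] at h
    simp only [ha, totalDegree_zero] at h3 ⊢
    have := h2 hb
    omega
  · by_cases hb : pderiv 1 f * pderiv 0 g = 0
    · have := h1 ha
      simp only [hb, totalDegree_zero] at h3 ⊢
      omega
    · have := h1 ha
      have := h2 hb
      omega

theorem totalDegree_aeval_pderiv_add_two_le [IsDomain R] {f g G : MvPolynomial (Fin 2) R}
    (hJ : jacobian f g ≠ 0) (hG : aeval ![f, g] (pderiv 1 G) ≠ 0) :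
    aeval ![f, g] G ≠ 0 ∧ (aeval ![f, g] (pderiv 1 G)).totalDegree + 2 ≤
      (aeval ![f, g] G).totalDegree + f.totalDegree := by
  have h := jacobian_aeval_right f g G
  have h0 : jacobian f (aeval ![f, g] G) ≠ 0 := by rw [h]; exact mul_ne_zero hG hJ
  refine ⟨fun hz => h0 (by rw [hz]; simp [jacobian]), ?_⟩
  have h1 := totalDegree_jacobian_add_two_le _ _ h0
  rw [h, totalDegree_mul_of_isDomain hG hJ] at h1
  omega

theorem totalDegree_aeval_iterate_pderiv_le [IsDomain R] {f g G : MvPolynomial (Fin 2) R}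
    (hJ : jacobian f g ≠ 0) (i : ℕ) (hG : aeval ![f, g] ((pderiv 1)^[i] G) ≠ 0) :
    (aeval ![f, g] ((pderiv 1)^[i] G)).totalDegree + 2 * i ≤
      (aeval ![f, g] G).totalDegree + i * f.totalDegree := by
  induction i with
  | zero => simp
  | succ i ih =>
    rw [Function.iterate_succ_apply'] at hG ⊢
    obtain ⟨h1, h2⟩ := totalDegree_aeval_pderiv_add_two_le hJ hG
    have := ih h1
    rw [add_mul]
    omega

end Jacobian

section Restriction

variable {R σ : Type*} [CommRing R]

/-- The univariate polynomial `T ↦ f (T v)`. -/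
noncomputable def restrictLine (v : σ → R) : MvPolynomial σ R →ₐ[R] Polynomial R :=
  aeval fun i => Polynomial.C (v i) * Polynomial.X

theorem restrictLine_monomial (v : σ → R) (s : σ →₀ ℕ) (c : R) :
    restrictLine v (monomial s c) =
      Polynomial.C (eval v (monomial s c)) * Polynomial.X ^ (s.sum fun _ e => e) := by
  rw [restrictLine, aeval_monomial, eval_monomial]
  simp only [mul_pow, Finsupp.prod, Finsupp.sum, Finset.prod_mul_distrib,
    Finset.prod_pow_eq_pow_sum, map_mul, map_prod, map_pow, Polynomial.algebraMap_eq, mul_assoc]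

theorem natDegree_restrictLine_le (v : σ → R) (f : MvPolynomial σ R) :
    (restrictLine v f).natDegree ≤ f.totalDegree := by
  conv_lhs => rw [f.as_sum, map_sum]
  refine Polynomial.natDegree_sum_le_of_forall_le _ _ fun s hs => ?_
  rw [restrictLine_monomial]
  exact (Polynomial.natDegree_C_mul_X_pow_le _ _).trans (le_totalDegree hs)

theorem coeff_restrictLine (v : σ → R) (n : ℕ) (f : MvPolynomial σ R) :
    (restrictLine v f).coeff n = eval v (homogeneousComponent n f) := by
  induction f using MvPolynomial.induction_on' with
  | add p q hp hq => simp only [map_add, Polynomial.coeff_add, hp, hq]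
  | monomial s c =>
    rw [restrictLine_monomial, Polynomial.coeff_C_mul_X_pow,
      homogeneousComponent_of_mem (isHomogeneous_monomial c rfl)]
    change (if n = s.degree then _ else _) = _
    split_ifs <;> simp

theorem coeff_restrictLine_smul (t : R) (v : σ → R) (n : ℕ) (f : MvPolynomial σ R) :
    (restrictLine (t • v) f).coeff n = (restrictLine v f).coeff n * t ^ n := by
  have : restrictLine (t • v) f = (restrictLine v f).comp (Polynomial.C t * Polynomial.X) := by
    induction f using MvPolynomial.induction_on with
    | C a => simp [restrictLine]
    | add p q hp hq => simp [hp, hq]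
    | mul_X p j hp =>
      simp only [map_mul, hp, Polynomial.mul_comp]
      simp [restrictLine]
      ring
  rw [this, Polynomial.comp_C_mul_X_coeff]

theorem restrictLine_aeval_pair (v : σ → R) (f g : MvPolynomial σ R)
    (G : MvPolynomial (Fin 2) R) :
    restrictLine v (aeval ![f, g] G) = aeval ![restrictLine v f, restrictLine v g] G := by
  rw [← AlgHom.comp_apply, comp_aeval]
  congr 2
  ext1 i
  fin_cases i <;> rfl

theorem exists_coeff_restrictLine_totalDegree_ne_zero [IsDomain R] [Infinite R]
    {f g : MvPolynomial σ R} (hf : f ≠ 0) (hg : g ≠ 0) :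
    ∃ v : σ → R, (restrictLine v f).coeff f.totalDegree ≠ 0 ∧
      (restrictLine v g).coeff g.totalDegree ≠ 0 := by
  have top : ∀ f : MvPolynomial σ R, f ≠ 0 → homogeneousComponent f.totalDegree f ≠ 0 := by
    intro f hf h
    obtain ⟨s, hs, hs'⟩ := Finset.exists_mem_eq_sup f.support (support_nonempty.mpr hf)
      fun s => s.sum fun _ e => e
    have := congrArg (coeff s) h
    rw [coeff_homogeneousComponent, if_pos, coeff_zero] at this
    · exact mem_support_iff.mp hs this
    · exact hs'.symm
  by_contra! h
  refine mul_ne_zero (top f hf) (top g hg) (MvPolynomial.funext fun v => ?_)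
  rw [map_mul, map_zero, ← coeff_restrictLine, ← coeff_restrictLine]
  by_cases h0 : (restrictLine v f).coeff f.totalDegree = 0
  · rw [h0, zero_mul]
  · rw [h v h0, mul_zero]

end Restriction

section WeightedLeadingForm

variable {R : Type*} [CommRing R]

/-- The component of weight `E` of a bivariate polynomial, for the weights `n` and `m` of the
variables, with the first variable specialised to `a`. -/
noncomputable def weightedSlice (a : R) (n m E : ℕ) :
    MvPolynomial (Fin 2) R →ₗ[R] Polynomial R :=
  (Polynomial.lcoeff (Polynomial R) E).restrictScalars R ∘ₗ
    (aeval ![Polynomial.C (Polynomial.C a) * Polynomial.X ^ n,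
      Polynomial.C Polynomial.X * Polynomial.X ^ m] :
      MvPolynomial (Fin 2) R →ₐ[R] Polynomial (Polynomial R)).toLinearMap

theorem weightedSlice_monomial (a : R) (n m E : ℕ) (s : Fin 2 →₀ ℕ) (c : R) :
    weightedSlice a n m E (monomial s c) =
      if E = n * s 0 + m * s 1 then Polynomial.C (c * a ^ s 0) * Polynomial.X ^ s 1 else 0 := by
  have : (aeval ![Polynomial.C (Polynomial.C a) * Polynomial.X ^ n,
      Polynomial.C Polynomial.X * Polynomial.X ^ m] (monomial s c) : Polynomial (Polynomial R)) =
      Polynomial.C (Polynomial.C (c * a ^ s 0) * Polynomial.X ^ s 1) *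
        Polynomial.X ^ (n * s 0 + m * s 1) := by
    rw [aeval_monomial, Finsupp.prod_fintype _ _ (by simp), Fin.prod_univ_two]
    simp only [Matrix.cons_val_zero, Matrix.cons_val_one, map_mul, map_pow,
      Polynomial.algebraMap_apply, Polynomial.algebraMap_eq]
    ring
  simp only [weightedSlice, LinearMap.comp_apply, AlgHom.toLinearMap_apply, this,
    LinearMap.restrictScalars_apply, Polynomial.lcoeff_apply, Polynomial.coeff_C_mul_X_pow]

theorem weightedSlice_pderiv (a : R) (n m E : ℕ) (G : MvPolynomial (Fin 2) R) :
    weightedSlice a n m E (pderiv 1 G) = (weightedSlice a n m (E + m) G).derivative := by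
  induction G using MvPolynomial.induction_on' with
  | add p q hp hq => simp only [map_add, hp, hq]
  | monomial s c =>
    rw [pderiv_monomial, weightedSlice_monomial, weightedSlice_monomial]
    rcases h : s 1 with _ | k
    · simp only [Nat.cast_zero, mul_zero, map_zero, zero_mul, ite_self, pow_zero, mul_one]
      split_ifs
      · rw [Polynomial.derivative_C]
      · rw [Polynomial.derivative_zero]
    · have h1 : (s - Finsupp.single 1 1 : Fin 2 →₀ ℕ) 0 = s 0 := by simp
      have h2 : (s - Finsupp.single 1 1 : Fin 2 →₀ ℕ) 1 = k := by simp [h]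
      have h3 : E + m = n * s 0 + m * (k + 1) ↔ E = n * s 0 + m * k := by
        rw [mul_add]; omega
      rw [h1, h2]
      simp only [h3]
      split_ifs
      · simp only [Polynomial.derivative_C_mul_X_pow, Nat.add_sub_cancel]
        rw [mul_right_comm c]
      · simp

theorem weightedSlice_iterate_pderiv (a : R) (n m E i : ℕ) (G : MvPolynomial (Fin 2) R) :
    weightedSlice a n m E ((pderiv 1)^[i] G) =
      Polynomial.derivative^[i] (weightedSlice a n m (E + i * m) G) := by
  induction i generalizing G with
  | zero => simp
  | succ i ih =>
    rw [Function.iterate_succ_apply, ih, weightedSlice_pderiv, Function.iterate_succ_apply, add_one_mul,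
      add_assoc]

theorem weight_le_of_mem_support_iterate_pderiv {n m D : ℕ} {G : MvPolynomial (Fin 2) R}
    (hG : ∀ s ∈ G.support, n * s 0 + m * s 1 ≤ D) (i : ℕ) :
    ∀ s ∈ ((pderiv 1)^[i] G).support, n * s 0 + m * s 1 + i * m ≤ D := by
  induction i with
  | zero => simpa using hG
  | succ i ih =>
    intro s hs
    rw [Function.iterate_succ_apply', mem_support_iff, coeff_pderiv] at hs
    have hs' : s + Finsupp.single 1 1 ∈ ((pderiv 1)^[i] G).support := by
      rw [mem_support_iff]; intro h0; simp [h0] at hs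
    have := ih _ hs'
    simp only [Finsupp.add_apply, Finsupp.single_eq_same, mul_add, mul_one] at this
    rw [Finsupp.single_eq_of_ne (by decide)] at this
    rw [add_mul]
    omega

theorem coeff_aeval_pair {n m E : ℕ} {p q : Polynomial R} (hp : p.natDegree ≤ n)
    (hq : q.natDegree ≤ m) {G : MvPolynomial (Fin 2) R}
    (hG : ∀ s ∈ G.support, n * s 0 + m * s 1 ≤ E) :
    (aeval ![p, q] G).coeff E = (weightedSlice (p.coeff n) n m E G).eval (q.coeff m) := by
  conv_lhs => rw [G.as_sum, map_sum, Polynomial.finsetSum_coeff]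
  conv_rhs => rw [G.as_sum, map_sum, Polynomial.eval_finsetSum]
  refine Finset.sum_congr rfl fun s hs => ?_
  have hp' : (p ^ s 0).natDegree ≤ n * s 0 := by
    rw [mul_comm]; exact Polynomial.natDegree_pow_le_of_le _ hp
  have hq' : (q ^ s 1).natDegree ≤ m * s 1 := by
    rw [mul_comm]; exact Polynomial.natDegree_pow_le_of_le _ hq
  have hpq := Polynomial.natDegree_mul_le_of_le hp' hq'
  rw [weightedSlice_monomial, aeval_monomial, Finsupp.prod_fintype _ _ (by simp),
    Fin.prod_univ_two, Polynomial.algebraMap_eq, Polynomial.coeff_C_mul]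
  simp only [Matrix.cons_val_zero, Matrix.cons_val_one]
  split_ifs with h
  · rw [h, Polynomial.coeff_mul_add_eq_of_natDegree_le hp' hq', mul_comm n, mul_comm m,
      Polynomial.coeff_pow_of_natDegree_le hp, Polynomial.coeff_pow_of_natDegree_le hq]
    simp [mul_assoc]
  · rw [Polynomial.coeff_eq_zero_of_natDegree_lt, mul_zero, Polynomial.eval_zero]
    have := hG s hs
    omega

theorem natDegree_weightedSlice_mul_le (a : R) (n m E : ℕ) (G : MvPolynomial (Fin 2) R) :
    (weightedSlice a n m E G).natDegree * m ≤ E := by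
  rcases Nat.eq_zero_or_pos m with rfl | hm
  · simp
  rw [← Nat.le_div_iff_mul_le hm, G.as_sum, map_sum]
  refine Polynomial.natDegree_sum_le_of_forall_le _ _ fun s _ => ?_
  rw [weightedSlice_monomial]
  split_ifs with h
  · refine (Polynomial.natDegree_C_mul_X_pow_le _ _).trans ?_
    rw [Nat.le_div_iff_mul_le hm, h, mul_comm]
    omega
  · simp

theorem weightedSlice_ne_zero [IsDomain R] {a : R} (ha : a ≠ 0) {n : ℕ} (hn : 0 < n) (m : ℕ)
    {G : MvPolynomial (Fin 2) R} {s : Fin 2 →₀ ℕ} (hs : s ∈ G.support) :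
    weightedSlice a n m (n * s 0 + m * s 1) G ≠ 0 := by
  intro h
  have h1 := congrArg (fun p => Polynomial.coeff p (s 1)) h
  simp only [Polynomial.coeff_zero] at h1
  rw [G.as_sum, map_sum, Polynomial.finsetSum_coeff, Finset.sum_eq_single s] at h1
  · rw [weightedSlice_monomial, if_pos rfl, Polynomial.coeff_C_mul_X_pow, if_pos rfl] at h1
    exact mul_ne_zero (mem_support_iff.mp hs) (pow_ne_zero _ ha) h1
  · intro t _ hts
    rw [weightedSlice_monomial]
    split_ifs with hw
    · rw [Polynomial.coeff_C_mul_X_pow, if_neg]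
      intro h01
      refine hts (Finsupp.ext fun i => ?_)
      fin_cases i
      · rw [h01] at hw
        exact (Nat.eq_of_mul_eq_mul_left hn (Nat.add_right_cancel hw)).symm
      · exact h01.symm
    · simp
  · exact fun h0 => absurd hs h0

end WeightedLeadingForm

theorem card_mul_le_natDegree_of_le_rootMultiplicity {R : Type*} [CommRing R] [IsDomain R]
    {p : Polynomial R} (S : Finset R) {i : ℕ} (h : ∀ b ∈ S, i ≤ p.rootMultiplicity b) :
    i * S.card ≤ p.natDegree := by
  classical
  have hle : i • S.val ≤ p.roots := by
    rw [Multiset.le_iff_count]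
    intro b
    rw [Multiset.count_nsmul, Polynomial.count_roots]
    by_cases hb : b ∈ S
    · rw [Multiset.count_eq_one_of_mem S.nodup hb, mul_one]
      exact h b hb
    · rw [Multiset.count_eq_zero_of_notMem hb]
      simp
  have := (Multiset.card_le_card hle).trans p.card_roots'
  simpa using this

/-- A lower bound for the degree of `∂ⁱG/∂Yⁱ (f, g)`, where `D` is the weighted degree of `G`:
for a suitable `i`, no cancellation occurs in the leading form. -/
theorem exists_le_totalDegree_aeval_iterate_pderiv {σ : Type*} {f g : MvPolynomial σ ℂ}
    (hf : 0 < f.totalDegree) (hg : 0 < g.totalDegree) {G : MvPolynomial (Fin 2) ℂ} (hG : G ≠ 0) :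
    ∃ i D : ℕ, (∀ s ∈ G.support, f.totalDegree * s 0 + g.totalDegree * s 1 ≤ D) ∧
      i * Nat.lcm f.totalDegree g.totalDegree ≤ D ∧
      aeval ![f, g] ((pderiv 1)^[i] G) ≠ 0 ∧
      D ≤ (aeval ![f, g] ((pderiv 1)^[i] G)).totalDegree + i * g.totalDegree := by
  classical
  have hf0 : f ≠ 0 := by rintro rfl; simp at hf
  have hg0 : g ≠ 0 := by rintro rfl; simp at hg
  obtain ⟨v, ha, hb⟩ := exists_coeff_restrictLine_totalDegree_ne_zero hf0 hg0
  set n := f.totalDegree with hn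
  set m := g.totalDegree with hm
  set a := (restrictLine v f).coeff n with ha'
  set b := (restrictLine v g).coeff m with hb'
  obtain ⟨s, hs, hsmax⟩ := Finset.exists_max_image G.support (fun s => n * s 0 + m * s 1)
    (support_nonempty.mpr hG)
  have hB := weightedSlice_ne_zero ha hf m hs
  have hdeg := natDegree_weightedSlice_mul_le a n m (n * s 0 + m * s 1) G
  set D := n * s 0 + m * s 1
  set B := weightedSlice a n m D G
  have hω := Complex.isPrimitiveRoot_exp n hf.ne'
  set ω := Complex.exp (2 * Real.pi * Complex.I / n)
  set p := n / n.gcd m with hp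
  have hd : 0 < n.gcd m := Nat.gcd_pos_of_pos_left _ hf
  have hp0 : 0 < p := Nat.div_pos (Nat.gcd_le_left _ hf) hd
  have hpm : p * m = n.lcm m := by
    rw [hp, Nat.lcm, Nat.div_mul_right_comm (Nat.gcd_dvd_left n m)]
  have hord : orderOf (ω ^ m) = p := by
    rw [orderOf_pow' _ hg.ne', ← hω.eq_orderOf]
  have hinj : Set.InjOn (fun k => b * (ω ^ k) ^ m) (Finset.range p : Set ℕ) := by
    intro k hk l hl hkl
    have h1 := mul_left_cancel₀ hb hkl
    rw [pow_right_comm, pow_right_comm ω l m] at h1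
    refine pow_injOn_Iio_orderOf ?_ ?_ h1
    · simpa [hord] using hk
    · simpa [hord] using hl
  obtain ⟨k, hk, hkmin⟩ := Finset.exists_min_image (Finset.range p)
    (fun k => B.rootMultiplicity (b * (ω ^ k) ^ m)) ⟨0, Finset.mem_range.mpr hp0⟩
  set i := B.rootMultiplicity (b * (ω ^ k) ^ m) with hi
  have hcard := card_mul_le_natDegree_of_le_rootMultiplicity
    ((Finset.range p).image fun k => b * (ω ^ k) ^ m) (p := B) (i := i)
    (by simpa using hkmin)
  rw [Finset.card_image_of_injOn hinj, Finset.card_range] at hcard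
  have hiD : i * n.lcm m ≤ D := by
    rw [← hpm, ← mul_assoc]
    exact (Nat.mul_le_mul_right m hcard).trans hdeg
  have him : i * m ≤ D :=
    (Nat.mul_le_mul_left i (Nat.le_of_dvd (Nat.lcm_pos hf hg) (Nat.dvd_lcm_right n m))).trans hiD
  obtain ⟨E, hE⟩ := Nat.exists_eq_add_of_le' him
  have hsupp := weight_le_of_mem_support_iterate_pderiv hsmax i
  have hcoeff : (restrictLine (ω ^ k • v) (aeval ![f, g] ((pderiv 1)^[i] G))).coeff E ≠ 0 := by
    rw [restrictLine_aeval_pair, coeff_aeval_pair (natDegree_restrictLine_le _ f)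
      (natDegree_restrictLine_le _ g) (fun t ht => by have := hsupp t ht; rw [← hn, ← hm]; omega),
      coeff_restrictLine_smul, coeff_restrictLine_smul, ← hn, ← hm, ← ha', ← hb',
      pow_right_comm ω k n, hω.pow_eq_one, one_pow, mul_one, weightedSlice_iterate_pderiv, ← hE, hi,
      Polynomial.eval_iterate_derivative_rootMultiplicity, nsmul_eq_mul]
    exact mul_ne_zero (Nat.cast_ne_zero.mpr (Nat.factorial_ne_zero _))
      (Polynomial.eval_divByMonic_pow_rootMultiplicity_ne_zero _ hB)
  refine ⟨i, D, hsmax, hiD, fun h0 => hcoeff (by rw [h0, map_zero, Polynomial.coeff_zero]), ?_⟩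
  have := (Polynomial.le_natDegree_of_ne_zero hcoeff).trans (natDegree_restrictLine_le _ _)
  omega

theorem dvd_totalDegree_of_aeval_eq_X {f g G : MvPolynomial (Fin 2) ℂ} (hJ : jacobian f g ≠ 0)
    {j : Fin 2} (hG : aeval ![f, g] G = X j) :
    f.totalDegree ∣ g.totalDegree ∨ g.totalDegree ∣ f.totalDegree := by
  by_contra! h
  obtain ⟨h1, h2⟩ := h
  have hn : 2 ≤ f.totalDegree := by
    rcases hf : f.totalDegree with _ | _ | k
    · simp [hf] at h2
    · simp [hf] at h1
    · omega
  have hm : 2 ≤ g.totalDegree := by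
    rcases hg : g.totalDegree with _ | _ | k
    · simp [hg] at h1
    · simp [hg] at h2
    · omega
  have hG0 : G ≠ 0 := by
    rintro rfl
    exact X_ne_zero (R := ℂ) j (by rw [← hG, map_zero])
  obtain ⟨i, D, hD, hlcm, hne, hle⟩ :=
    exists_le_totalDegree_aeval_iterate_pderiv (f := f) (g := g) (by omega) (by omega) hG0
  have hup := totalDegree_aeval_iterate_pderiv_le hJ i hne
  rw [hG, totalDegree_X] at hup
  set n := f.totalDegree
  set m := g.totalDegree
  have hsum : n + m ≤ n.lcm m := by
    have hpos : 0 < n.lcm m := Nat.lcm_pos (by omega) (by omega)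
    obtain ⟨s, hs⟩ := Nat.dvd_lcm_left n m
    obtain ⟨t, ht⟩ := Nat.dvd_lcm_right n m
    have hs2 : 2 ≤ s := by
      rcases s with _ | _ | s
      · simp [hs] at hpos
      · exact absurd (hs ▸ Nat.dvd_lcm_right n m) (by simpa using h2)
      · omega
    have ht2 : 2 ≤ t := by
      rcases t with _ | _ | t
      · simp [ht] at hpos
      · exact absurd (ht ▸ Nat.dvd_lcm_left n m) (by simpa using h1)
      · omega
    have := Nat.mul_le_mul_left n hs2
    have := Nat.mul_le_mul_left m ht2
    omega
  have := Nat.mul_le_mul_left i hsum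
  rw [mul_add] at this
  have hi : i = 0 := by omega
  subst hi
  have hD1 : D ≤ 1 := by omega
  have hconst : G = C (coeff 0 G) := by
    rw [← totalDegree_eq_zero_iff_eq_C, totalDegree_eq_zero_iff]
    intro s hs x
    have := hD s hs
    have h0 : s 0 = 0 := by by_contra h0; have := Nat.mul_le_mul hn (Nat.pos_of_ne_zero h0); omega
    have h1 : s 1 = 0 := by by_contra h0; have := Nat.mul_le_mul hm (Nat.pos_of_ne_zero h0); omega
    fin_cases x
    · exact h0
    · exact h1
  rw [hconst, aeval_C] at hG
  have := congrArg totalDegree hG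
  rw [totalDegree_X, algebraMap_eq, totalDegree_C] at this
  omega

theorem IsPolyAut.exists_left_inverse {P Q : MvPolynomial (Fin 2) ℂ} (h : IsPolyAut P Q) :
    ∃ G H : MvPolynomial (Fin 2) ℂ, aeval ![P, Q] G = X 0 ∧ aeval ![P, Q] H = X 1 := by
  obtain ⟨G, H, h, -⟩ := h
  have key : ∀ (v : Fin 2 → ℂ) (K : MvPolynomial (Fin 2) ℂ),
      eval v (aeval ![P, Q] K) = eval ![eval v P, eval v Q] K := by
    intro v K
    induction K using MvPolynomial.induction_on with
    | C a => simp
    | add p q hp hq => simp only [map_add, hp, hq]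
    | mul_X p j hp => fin_cases j <;> simp [hp, -aeval_eq_bind₁]
  refine ⟨G, H, MvPolynomial.funext fun v => ?_, MvPolynomial.funext fun v => ?_⟩
  · rw [key, (h v).1, eval_X]
  · rw [key, (h v).2, eval_X]

/-- **Division Lemma.** If `F = (P, Q)` is a polynomial automorphism of ℂ², then
`deg P` divides `deg Q` or `deg Q` divides `deg P` (total degrees). -/
theorem division_lemma (P Q : MvPolynomial (Fin 2) ℂ) (h : IsPolyAut P Q) :
    P.totalDegree ∣ Q.totalDegree ∨ Q.totalDegree ∣ P.totalDegree := by
  obtain ⟨G, H, hG, hH⟩ := h.exists_left_inverse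
  exact dvd_totalDegree_of_aeval_eq_X (jacobian_ne_zero_of_left_inverse hG hH) hG
end

section
/- If F = (P,Q) is a polynomial automorphism of ℂ², then each of the polynomials P and Q is irreducible in ℂ[x,y]. -/
open MvPolynomial

theorem aeval_eq_X_of_eval_eq {σ R : Type*} [CommRing R] [IsDomain R] [Infinite R]
    (F : σ → MvPolynomial σ R) (G : MvPolynomial σ R) (i : σ)
    (h : ∀ v : σ → R, eval (fun j => eval v (F j)) G = v i) : aeval F G = X i := by
  refine MvPolynomial.funext fun v => ?_
  rw [eval_X, ← h v, aeval_eq_bind₁, ← coe_aeval_eq_eval, RingHom.coe_coe, aeval_bind₁]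
  rfl

/-- A polynomial self-map of affine space with a polynomial inverse induces an automorphism
of the polynomial ring, so its components are irreducible. -/
theorem irreducible_of_polynomial_inverse {σ R : Type*} [CommRing R] [IsDomain R] [Infinite R]
    (F G : σ → MvPolynomial σ R)
    (hGF : ∀ (v : σ → R) i, eval (fun j => eval v (F j)) (G i) = v i)
    (hFG : ∀ (v : σ → R) i, eval (fun j => eval v (G j)) (F i) = v i) (i : σ) :
    Irreducible (F i) := by
  let e : MvPolynomial σ R ≃ₐ[R] MvPolynomial σ R :=
    AlgEquiv.ofAlgHom (aeval F) (aeval G)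
      (algHom_ext fun j => by simpa using aeval_eq_X_of_eval_eq F (G j) j (hGF · j))
      (algHom_ext fun j => by simpa using aeval_eq_X_of_eval_eq G (F j) j (hFG · j))
  have he : e (X i) = F i := aeval_X F i
  rw [← he, MulEquiv.irreducible_iff]
  exact X_prime.irreducible

/-- If `F = (P, Q)` is a polynomial automorphism of ℂ², then both `P` and `Q`
are irreducible in ℂ[x,y]. -/
theorem components_of_aut_irreducible (P Q : MvPolynomial (Fin 2) ℂ)
    (h : IsPolyAut P Q) : Irreducible P ∧ Irreducible Q := by
  obtain ⟨P', Q', hl, hr⟩ := h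
  have eval_pair (A B : MvPolynomial (Fin 2) ℂ) (v : Fin 2 → ℂ) :
      (fun j => eval v (![A, B] j)) = ![eval v A, eval v B] := by
    ext j
    fin_cases j <;> rfl
  have irr := irreducible_of_polynomial_inverse ![P, Q] ![P', Q']
    (fun v => by
      rw [eval_pair]
      exact Fin.forall_fin_two.2 (hl v))
    (fun v => by
      rw [eval_pair]
      exact Fin.forall_fin_two.2 (hr v))
  exact ⟨irr 0, irr 1⟩
end

section
/- Let f, g ∈ ℂ[x,y] be nonzero homogeneous polynomials with f_x g_y − f_y g_x ≡ 0. Then there exist a homogeneous polynomial h ∈ ℂ[x,y] with deg h = gcd(deg f, deg g) and nonzero constants a, b ∈ ℂ* such that f = a·h^(deg f / deg h) and g = b·h^(deg g / deg h). -/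
open MvPolynomial

/-- Two univariate polynomials over a field of characteristic zero with vanishing Wronskian are
proportional. -/
lemma Polynomial.exists_eq_C_mul_of_wronskian_eq_zero {K : Type*} [Field K] [CharZero K]
    {A B : Polynomial K} (hA : A ≠ 0) (hB : B ≠ 0) (hw : A.wronskian B = 0) :
    ∃ c : K, c ≠ 0 ∧ A = Polynomial.C c * B := by
  classical
  obtain ⟨q, A₁, B₁, hq, hcop, rfl, rfl⟩ :
      ∃ q A₁ B₁ : Polynomial K, q ≠ 0 ∧ IsCoprime A₁ B₁ ∧ A = q * A₁ ∧ B = q * B₁ := by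
    obtain ⟨A₁, hA₁⟩ := EuclideanDomain.gcd_dvd_left A B
    obtain ⟨B₁, hB₁⟩ := EuclideanDomain.gcd_dvd_right A B
    have hq : EuclideanDomain.gcd A B ≠ 0 := fun h ↦ hA (EuclideanDomain.gcd_eq_zero_iff.1 h).1
    refine ⟨_, A₁, B₁, hq, ⟨EuclideanDomain.gcdA A B, EuclideanDomain.gcdB A B, ?_⟩, hA₁, hB₁⟩
    have h := EuclideanDomain.gcd_eq_gcd_ab A B
    refine mul_left_cancel₀ hq ?_
    linear_combination (-1 : Polynomial K) * h - EuclideanDomain.gcdA A B * hA₁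
      - EuclideanDomain.gcdB A B * hB₁
  have hw₁ : A₁.wronskian B₁ = 0 := by
    have h : q ^ 2 * A₁.wronskian B₁ = 0 := by
      rw [← hw]
      simp only [Polynomial.wronskian, Polynomial.derivative_mul]
      ring
    exact (mul_eq_zero.1 h).resolve_left (pow_ne_zero _ hq)
  obtain ⟨hdA, hdB⟩ := hcop.wronskian_eq_zero_iff.1 hw₁
  obtain ⟨a, rfl⟩ := Polynomial.natDegree_eq_zero.1 (Polynomial.derivative_eq_zero.1 hdA)
  obtain ⟨b, rfl⟩ := Polynomial.natDegree_eq_zero.1 (Polynomial.derivative_eq_zero.1 hdB)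
  have ha : a ≠ 0 := by rintro rfl; simp at hA
  have hb : b ≠ 0 := by rintro rfl; simp at hB
  refine ⟨a / b, div_ne_zero ha hb, ?_⟩
  rw [mul_left_comm, ← Polynomial.C_mul, div_mul_cancel₀ _ hb]

namespace MvPolynomial

section Grading

variable {σ R : Type*} [CommRing R]

/-- The algebra homomorphism `F(x) ↦ F(T x)`, which records the grading by the powers of `T`. -/
noncomputable def gradingHom (σ R : Type*) [CommRing R] :
    MvPolynomial σ R →ₐ[R] Polynomial (MvPolynomial σ R) :=
  aeval fun i ↦ Polynomial.C (X i) * Polynomial.X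

lemma coeff_gradingHom (F : MvPolynomial σ R) (n : ℕ) :
    (gradingHom σ R F).coeff n = homogeneousComponent n F := by
  induction F using MvPolynomial.induction_on' with
  | add p q hp hq => simp [hp, hq]
  | monomial s r =>
    have h : gradingHom σ R (monomial s r) =
        Polynomial.C (monomial s r) * Polynomial.X ^ s.degree := by
      rw [gradingHom, aeval_monomial, monomial_eq, Finsupp.prod, Finsupp.prod]
      simp only [mul_pow, Finset.prod_mul_distrib, Finset.prod_pow_eq_pow_sum, map_mul, map_prod,
        map_pow, Finsupp.degree]
      rw [mul_assoc]
      rfl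
    rw [h, Polynomial.coeff_C_mul_X_pow]
    split_ifs with hn
    · exact (homogeneousComponent_eq_self (isHomogeneous_monomial r hn.symm)).symm
    · rw [homogeneousComponent_of_mem (isHomogeneous_monomial r rfl), if_neg hn]

lemma isHomogeneous_iff_gradingHom {F : MvPolynomial σ R} {n : ℕ} :
    F.IsHomogeneous n ↔ gradingHom σ R F = Polynomial.C F * Polynomial.X ^ n := by
  constructor
  · intro h
    ext1 k
    rw [coeff_gradingHom, Polynomial.coeff_C_mul_X_pow, homogeneousComponent_of_mem h]
  · intro h
    have hk := coeff_gradingHom F n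
    rw [h, Polynomial.coeff_C_mul_X_pow, if_pos rfl] at hk
    rw [hk]
    exact homogeneousComponent_isHomogeneous n F

lemma eval₂_gradingHom (F : MvPolynomial σ R) (v : σ → R) (t : R) :
    (gradingHom σ R F).eval₂ (eval v) t = eval (fun i ↦ v i * t) F := by
  induction F using MvPolynomial.induction_on with
  | C a =>
    rw [eval_C, ← algebraMap_eq, AlgHom.commutes, Polynomial.algebraMap_apply, Polynomial.eval₂_C,
      algebraMap_eq, eval_C]
  | add p q hp hq => rw [map_add, Polynomial.eval₂_add, hp, hq, map_add]
  | mul_X p i hp =>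
    rw [map_mul, Polynomial.eval₂_mul, hp, map_mul, eval_X]
    simp [gradingHom]

lemma IsHomogeneous.eval_mul_right {F : MvPolynomial σ R} {n : ℕ} (hF : F.IsHomogeneous n)
    (v : σ → R) (t : R) : eval (fun i ↦ v i * t) F = eval v F * t ^ n := by
  have h := congrArg (Polynomial.eval₂ (eval v) t) (isHomogeneous_iff_gradingHom.1 hF)
  rw [Polynomial.eval₂_mul, Polynomial.eval₂_C, Polynomial.eval₂_pow, Polynomial.eval₂_X] at h
  rw [← h, eval₂_gradingHom]

end Grading

end MvPolynomial

lemma eq_of_pow_eq_of_coprime {R : Type*} [CommRing R] [IsDomain R] {a b : R} {m n : ℕ}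
    (hmn : m.Coprime n) (hb : b ≠ 0) (hm : a ^ m = b ^ m) (hn : a ^ n = b ^ n) : a = b := by
  let i := algebraMap R (FractionRing R)
  have hi : Function.Injective i := IsFractionRing.injective R (FractionRing R)
  have hib : i b ≠ 0 := (map_ne_zero_iff i hi).2 hb
  refine hi ((div_eq_one_iff_eq hib).1 ((pow_eq_one_iff_of_coprime hmn).1 ⟨?_, ?_⟩))
  · rw [div_pow, ← map_pow, hm, map_pow, div_self (pow_ne_zero _ hib)]
  · rw [div_pow, ← map_pow, hn, map_pow, div_self (pow_ne_zero _ hib)]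

lemma IsIntegrallyClosed.exists_eq_pow_of_pow_eq {R : Type*} [CommRing R] [IsDomain R]
    [IsIntegrallyClosed R] {a b : R} {m n : ℕ} (hmn : m.Coprime n) (h : a ^ m = b ^ n) :
    ∃ c : R, a = c ^ n ∧ b = c ^ m := by
  let i := algebraMap R (FractionRing R)
  have hi : Function.Injective i := IsFractionRing.injective R (FractionRing R)
  obtain ⟨c, hc, hc'⟩ := (pow_eq_pow_iff_of_coprime (a := i a) (b := i b) hmn).1 (by
    rw [← map_pow, h, map_pow])
  obtain ⟨y, rfl⟩ : ∃ y, i y = c := by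
    rcases Nat.eq_zero_or_pos n with rfl | hn
    · have hm : m = 1 := by simpa using hmn
      exact ⟨b, by rw [hc', hm, pow_one]⟩
    · exact IsIntegrallyClosed.exists_algebraMap_eq_of_isIntegral_pow hn
        (hc ▸ isIntegral_algebraMap)
  exact ⟨y, hi (by rw [hc, map_pow]), hi (by rw [hc', map_pow])⟩

namespace MvPolynomial

lemma IsHomogeneous.of_pow_of_coprime {σ R : Type*} [CommRing R] [IsDomain R]
    {h : MvPolynomial σ R} {d m n : ℕ} (hmn : m.Coprime n) (hh : h ≠ 0)
    (hm : (h ^ m).IsHomogeneous (d * m)) (hn : (h ^ n).IsHomogeneous (d * n)) :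
    h.IsHomogeneous d := by
  rw [isHomogeneous_iff_gradingHom, map_pow, map_pow, pow_mul, ← mul_pow] at hm hn
  exact isHomogeneous_iff_gradingHom.2 (eq_of_pow_eq_of_coprime hmn (by simpa using hh) hm hn)

section Dehomogenization

variable {K : Type*} [Field K]

/-- Dehomogenization `F(x, y) ↦ F(x, 1)` of a polynomial in two variables. -/
noncomputable def dehomogenize (K : Type*) [Field K] :
    MvPolynomial (Fin 2) K →ₐ[K] Polynomial K :=
  aeval ![Polynomial.X, 1]

lemma derivative_dehomogenize (F : MvPolynomial (Fin 2) K) :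
    Polynomial.derivative (dehomogenize K F) = dehomogenize K (pderiv 0 F) := by
  induction F using MvPolynomial.induction_on with
  | C a => simp [dehomogenize]
  | add p q hp hq => simp [hp, hq]
  | mul_X p i hp =>
    fin_cases i <;> (simp [dehomogenize, pderiv_X] at hp ⊢; rw [hp]; try ring)

lemma IsHomogeneous.eq_zero_of_dehomogenize_eq_zero [Infinite K]
    {F : MvPolynomial (Fin 2) K} {n : ℕ} (hF : F.IsHomogeneous n) (h : dehomogenize K F = 0) :
    F = 0 := by
  have hX : X 1 * F = 0 := by
    refine MvPolynomial.funext fun v ↦ ?_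
    rw [map_mul, eval_X, map_zero, mul_eq_zero]
    refine or_iff_not_imp_left.2 fun hv ↦ ?_
    have h₁ := hF.eval_mul_right ![v 0 / v 1, 1] (v 1)
    have h₂ : eval ![v 0 / v 1, 1] F = (dehomogenize K F).eval (v 0 / v 1) := by
      clear h₁ h hF
      induction F using MvPolynomial.induction_on with
      | C a => simp [dehomogenize]
      | add p q hp hq => simp [hp, hq]
      | mul_X p i hp => fin_cases i <;> simp [dehomogenize] at hp ⊢ <;> simp [hp]
    have h₃ : (fun i ↦ ![v 0 / v 1, 1] i * v 1) = v := by
      ext i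
      fin_cases i <;> simp [hv]
    rw [h₂, h, Polynomial.eval_zero, zero_mul, h₃] at h₁
    exact h₁
  exact (mul_eq_zero.1 hX).resolve_left (X_ne_zero 1)

lemma IsHomogeneous.exists_eq_C_mul_of_pderiv [CharZero K] {F G : MvPolynomial (Fin 2) K} {n : ℕ}
    (hF : F.IsHomogeneous n) (hG : G.IsHomogeneous n) (hF0 : F ≠ 0) (hG0 : G ≠ 0)
    (hFG : F * pderiv 0 G = pderiv 0 F * G) : ∃ c : K, c ≠ 0 ∧ F = C c * G := by
  obtain ⟨c, hc, h⟩ := Polynomial.exists_eq_C_mul_of_wronskian_eq_zero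
    (fun h ↦ hF0 (hF.eq_zero_of_dehomogenize_eq_zero h))
    (fun h ↦ hG0 (hG.eq_zero_of_dehomogenize_eq_zero h)) (by
      rw [Polynomial.wronskian, derivative_dehomogenize, derivative_dehomogenize, ← map_mul,
        ← map_mul, hFG, sub_self])
  refine ⟨c, hc, sub_eq_zero.1 ((hF.sub (hG.C_mul c)).eq_zero_of_dehomogenize_eq_zero ?_)⟩
  rw [map_sub, map_mul, h, sub_eq_zero]
  simp [dehomogenize]

end Dehomogenization

lemma mul_pderiv_pow {σ R : Type*} [CommRing R] (i : σ) (f : MvPolynomial σ R) (k : ℕ) :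
    f * pderiv i (f ^ k) = k * f ^ k * pderiv i f := by
  rcases k with _ | k
  · simp
  · rw [pderiv_pow]
    simp only [Nat.add_sub_cancel]
    ring

/-- Vanishing of the Jacobian of two homogeneous polynomials says, by Euler's identity, that
their logarithmic derivatives are proportional to their degrees. -/
lemma IsHomogeneous.degree_mul_pderiv_of_jacobian_eq_zero {R : Type*} [CommRing R]
    {f g : MvPolynomial (Fin 2) R} {m n : ℕ} (hf : f.IsHomogeneous m) (hg : g.IsHomogeneous n)
    (hJ : pderiv 0 f * pderiv 1 g - pderiv 1 f * pderiv 0 g = 0) :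
    (n : MvPolynomial (Fin 2) R) * g * pderiv 0 f = m * f * pderiv 0 g := by
  have ef := hf.sum_X_mul_pderiv
  have eg := hg.sum_X_mul_pderiv
  rw [Fin.sum_univ_two, nsmul_eq_mul] at ef eg
  linear_combination pderiv 0 g * ef - pderiv 0 f * eg + X 1 * hJ

end MvPolynomial

/-- Let `f, g ∈ ℂ[x,y]` be nonzero homogeneous polynomials (of degrees `m`, `n`)
whose Jacobian determinant `f_x g_y − f_y g_x` vanishes identically. Then there
exist a nonzero homogeneous polynomial `h` of degree `gcd(m, n)` and nonzero
constants `a, b ∈ ℂ*` with `f = a·h^(m / gcd(m,n))` and `g = b·h^(n / gcd(m,n))`. -/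
theorem homogeneous_zero_jacobian_common_power
    (f g : MvPolynomial (Fin 2) ℂ) (m n : ℕ)
    (hf : f.IsHomogeneous m) (hg : g.IsHomogeneous n)
    (hf0 : f ≠ 0) (hg0 : g ≠ 0)
    (hJ : pderiv 0 f * pderiv 1 g - pderiv 1 f * pderiv 0 g = 0) :
    ∃ (h : MvPolynomial (Fin 2) ℂ) (a b : ℂ),
      h.IsHomogeneous (Nat.gcd m n) ∧ h ≠ 0 ∧ a ≠ 0 ∧ b ≠ 0 ∧
      f = C a * h ^ (m / Nat.gcd m n) ∧ g = C b * h ^ (n / Nat.gcd m n) := by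
  rcases Nat.eq_zero_or_pos (Nat.gcd m n) with h0 | h0
  · obtain ⟨rfl, rfl⟩ := Nat.gcd_eq_zero_iff.1 h0
    have hf' := totalDegree_eq_zero_iff_eq_C.1 (((totalDegree_zero_iff_isHomogeneous _).2 hf))
    have hg' := totalDegree_eq_zero_iff_eq_C.1 (((totalDegree_zero_iff_isHomogeneous _).2 hg))
    refine ⟨1, coeff 0 f, coeff 0 g, by simpa using isHomogeneous_one _ _, one_ne_zero,
      fun h ↦ hf0 (by rw [hf', h, C_0]), fun h ↦ hg0 (by rw [hg', h, C_0]), ?_, ?_⟩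
    · simpa using hf'
    · simpa using hg'
  have hE := hf.degree_mul_pderiv_of_jacobian_eq_zero hg hJ
  obtain ⟨d, m', n', hd, hcop, rfl, rfl⟩ := Nat.exists_coprime' h0
  have hgcd : Nat.gcd (m' * d) (n' * d) = d := by rw [Nat.gcd_mul_right, hcop.gcd_eq_one, one_mul]
  rw [hgcd, Nat.mul_div_cancel _ hd, Nat.mul_div_cancel _ hd]
  have hE' : (n' : MvPolynomial (Fin 2) ℂ) * g * pderiv 0 f = m' * f * pderiv 0 g := by
    have hd' : (d : MvPolynomial (Fin 2) ℂ) ≠ 0 := Nat.cast_ne_zero.2 hd.ne'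
    refine mul_left_cancel₀ hd' ?_
    push_cast at hE
    linear_combination hE
  obtain ⟨c, hc, hfg⟩ : ∃ c : ℂ, c ≠ 0 ∧ f ^ n' = C c * g ^ m' := by
    have hF := hf.pow n'
    have hG := hg.pow m'
    rw [show n' * d * m' = m' * d * n' by ring] at hG
    refine hF.exists_eq_C_mul_of_pderiv hG (pow_ne_zero _ hf0) (pow_ne_zero _ hg0) ?_
    refine mul_left_cancel₀ (mul_ne_zero hf0 hg0) ?_
    linear_combination f * f ^ n' * mul_pderiv_pow 0 g m' - g * g ^ m' * mul_pderiv_pow 0 f n'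
      - f ^ n' * g ^ m' * hE'
  obtain ⟨a, b, ha, hb, hab⟩ : ∃ a b : ℂ, a ≠ 0 ∧ b ≠ 0 ∧ a ^ n' = c * b ^ m' := by
    rcases Nat.eq_zero_or_pos n' with rfl | hn
    · have hm : m' = 1 := by simpa using hcop
      exact ⟨1, c⁻¹, one_ne_zero, inv_ne_zero hc, by simp [hm, hc]⟩
    · obtain ⟨a, rfl⟩ := IsAlgClosed.exists_pow_nat_eq c hn
      refine ⟨a, 1, ?_, one_ne_zero, by simp⟩
      rintro rfl
      exact hc (zero_pow hn.ne')
  obtain ⟨h, hfh, hgh⟩ := IsIntegrallyClosed.exists_eq_pow_of_pow_eq hcop.symm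
    (a := C a⁻¹ * f) (b := C b⁻¹ * g) (by
      rw [mul_pow, mul_pow, hfg, ← C_pow, ← C_pow, ← mul_assoc, ← C_mul, inv_pow, hab, inv_pow]
      congr 2
      field_simp)
  have hh : h ≠ 0 := by
    rintro rfl
    rcases Nat.eq_zero_or_pos m' with rfl | hm
    · have hn : n' = 1 := by simpa using hcop
      simp [hn, hb, hg0] at hgh
    · simp [hm.ne', ha, hf0] at hfh
  refine ⟨h, a, b, ?_, hh, ha, hb, ?_, ?_⟩
  · refine IsHomogeneous.of_pow_of_coprime hcop hh ?_ ?_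
    · rw [← hfh, mul_comm d]
      exact hf.C_mul _
    · rw [← hgh, mul_comm d]
      exact hg.C_mul _
  · rw [← hfh, ← mul_assoc, ← C_mul, mul_inv_cancel₀ ha, C_1, one_mul]
  · rw [← hgh, ← mul_assoc, ← C_mul, mul_inv_cancel₀ hb, C_1, one_mul]
end
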